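/- Let M be a countable transitive set with (M,∈) ⊨ ZF, let ⟨P,≼,𝟙⟩ ∈ M be a forcing notion, and let G be an M-generic filter on P. Then (M[G],∈) ⊨ ZF. -/

import Mathlib

namespace CtmForcing

open FirstOrder FirstOrder.Language

/-! ### The first-order language of set theory -/

/-- The relation symbols of the language of set theory: a single binary relation `∈`. -/
inductive memRel : ℕ → Type
  | mem : memRel 2

/-- The first-order language `L` of set theory, with a single binary relation symbol `∈`. -/
def SetLang : Language := ⟨fun _ => Empty, memRel⟩

/-- The membership relation symbol. -/
abbrev memSymb : SetLang.Relations 2 := .mem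

/-- `L`-formulas (with no free "unbounded" variables) whose free variables are among
`v₀, …, v_{n-1}`. -/
abbrev BF (n : ℕ) := SetLang.BoundedFormula Empty n

/-- The atomic formula `vᵢ ∈ vⱼ`. -/
def memf {n : ℕ} (i j : Fin n) : BF n :=
  memSymb.boundedFormula₂ (Term.var (Sum.inr i)) (Term.var (Sum.inr j))

/-- The atomic formula `vᵢ = vⱼ`. -/
def eqf {n : ℕ} (i j : Fin n) : BF n :=
  Term.bdEqual (Term.var (Sum.inr i)) (Term.var (Sum.inr j))

/-- Rename the free variables of a formula along `f`. -/
def reindex {m k : ℕ} (f : Fin m → Fin k) (φ : BF m) : BF k :=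
  (BoundedFormula.relabel (Sum.map id f) φ.toFormula : SetLang.BoundedFormula Empty (k + 0))

/-- Conjunction. -/
def andF {n : ℕ} (φ ψ : BF n) : BF n := (φ.imp ψ.not).not

/-- Disjunction. -/
def orF {n : ℕ} (φ ψ : BF n) : BF n := (φ.not).imp ψ

/-- Biimplication. -/
def iffF {n : ℕ} (φ ψ : BF n) : BF n := andF (φ.imp ψ) (ψ.imp φ)

/-! ### Basic set-theoretic formulas -/

/-- `v₀ ⊆ v₁`. -/
def subF : BF 2 := ((memf 2 0).imp (memf 2 1)).all

/-- `v₀ = ∅`. -/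
def emptyF : BF 1 := ((memf 1 0).not).all

/-- `v₂ = {v₀, v₁}`. -/
def pairSetF : BF 3 := (iffF (memf 3 2) (orF (eqf 3 0) (eqf 3 1))).all

/-- `v₁ = {v₀}`. -/
def singF : BF 2 := reindex ![0, 0, 1] pairSetF

/-- `v₂ = ⟨v₀, v₁⟩` (Kuratowski ordered pair). -/
def opF : BF 3 :=
  (iffF (memf 3 2) (orF (reindex ![0, 3] singF) (reindex ![0, 1, 3] pairSetF))).all

/-- `v₁ = v₀ ∪ {v₀}`. -/
def succF : BF 2 := (iffF (memf 2 1) (orF (memf 2 0) (eqf 2 0))).all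

/-- `v₀` is transitive. -/
def transF : BF 1 := ((memf 1 0).imp (reindex ![1, 0] subF)).all

/-- `v₀` is an ordinal (a transitive set of transitive sets). -/
def ordF : BF 1 := andF transF (((memf 1 0).imp (reindex ![1] transF)).all)

/-- `⟨v₀, v₁⟩ ∈ v₂`. -/
def relMemF : BF 3 := (andF (reindex ![0, 1, 3] opF) (memf 3 2)).ex

/-- `v₂` is a function with domain `v₀` mapping onto `v₁` (a surjection from `v₀` onto `v₁`). -/
def isFuncF : BF 3 :=
  andF
    (andF
      -- v₂ ⊆ v₀ × v₁
      (((memf 3 2).imp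
        (((andF (andF (memf 4 0) (memf 5 1)) (reindex ![4, 5, 3] opF)).ex).ex)).all)
      -- total on v₀
      (((memf 3 0).imp ((andF (memf 4 1) (reindex ![3, 4, 2] relMemF)).ex)).all))
    (andF
      -- functional
      ((((andF (reindex ![3, 4, 2] relMemF) (reindex ![3, 5, 2] relMemF)).imp
          (eqf 4 5)).all).all.all)
      -- onto v₁
      (((memf 3 1).imp ((andF (memf 4 0) (reindex ![4, 3, 2] relMemF)).ex)).all))

/-- `v₂` is injective (as a set of ordered pairs). -/
def injF : BF 3 :=
  ((((andF (reindex ![3, 5, 2] relMemF) (reindex ![4, 5, 2] relMemF)).imp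
      (eqf 3 4)).all).all).all

/-- `v₂` is a bijection from `v₀` onto `v₁`. -/
def bijF : BF 3 := andF isFuncF injF

/-! ### The axioms of set theory as `L`-sentences -/

/-- Extensionality. -/
def extAx : SetLang.Sentence :=
  ((((andF subF (reindex ![1, 0] subF)).imp (eqf 0 1)).all).all : BF 0)

/-- Foundation. -/
def foundAx : SetLang.Sentence :=
  (((((memf 1 0).ex).imp
    ((andF (memf 1 0) (((memf 2 0).imp ((memf 2 1).not)).all)).ex)).all) : BF 0)

/-- Pairing. -/
def pairAx : SetLang.Sentence := (((pairSetF.ex).all).all : BF 0)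

/-- Union. -/
def unionAx : SetLang.Sentence :=
  (((((iffF (memf 2 1) ((andF (memf 3 0) (memf 2 3)).ex)).all).ex).all : BF 0))

/-- Powerset. -/
def powF : BF 2 := (iffF (memf 2 1) (reindex ![2, 0] subF)).all

/-- Powerset axiom. -/
def powAx : SetLang.Sentence := (((powF.ex).all) : BF 0)

/-- Infinity. -/
def infAx : SetLang.Sentence :=
  (((andF ((andF (memf 1 0) (reindex ![1] emptyF)).ex)
    (((memf 1 0).imp ((andF (memf 2 0) (reindex ![1, 2] succF)).ex)).all)).ex) : BF 0)

/-- The instance of the Separation scheme given by `φ`, whose free variables are among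
`v₀, …, vₙ`: the parameters are `v₀, …, v_{n-1}` and the tested element is `vₙ`.  It is the
universal closure of `∀A ∃B ∀x (x ∈ B ↔ x ∈ A ∧ φ(params, x))`. -/
def sepAx {n : ℕ} (φ : BF (n + 1)) : SetLang.Sentence :=
  -- context `n+3`: parameters `0,…,n-1`, `A = n`, `B = n+1`, `x = n+2`
  let A : Fin (n + 3) := ⟨n, by omega⟩
  let B : Fin (n + 3) := ⟨n + 1, by omega⟩
  let x : Fin (n + 3) := ⟨n + 2, by omega⟩
  let φ' : BF (n + 3) := reindex (fun i => if h : (i : ℕ) < n then ⟨i, by omega⟩ else x) φ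
  ((((iffF (memf x B) (andF (memf x A) φ')).all).ex).all).alls

/-- The instance of the Replacement scheme given by `φ`, whose free variables are among
`v₀, …, v_{n+1}`: the parameters are `v₀, …, v_{n-1}`, the argument is `x = vₙ`, and the
value is `y = v_{n+1}`.  It is the universal closure of
`∀A [(∀x∈A ∀y ∀y' (φ(x,y) ∧ φ(x,y') → y = y')) → ∃B ∀y (y ∈ B ↔ ∃x∈A φ(x,y))]`. -/
def replAx {n : ℕ} (φ : BF (n + 2)) : SetLang.Sentence :=
  -- functionality context `n+4`: parameters, `A = n`, `x = n+1`, `y = n+2`, `y' = n+3`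
  let A : Fin (n + 4) := ⟨n, by omega⟩
  let x : Fin (n + 4) := ⟨n + 1, by omega⟩
  let y : Fin (n + 4) := ⟨n + 2, by omega⟩
  let y' : Fin (n + 4) := ⟨n + 3, by omega⟩
  let φ₁ : BF (n + 4) :=
    reindex (fun i => if h : (i : ℕ) < n then ⟨i, by omega⟩ else if (i : ℕ) = n then x else y) φ
  let φ₂ : BF (n + 4) :=
    reindex (fun i => if h : (i : ℕ) < n then ⟨i, by omega⟩ else if (i : ℕ) = n then x else y') φ
  let funcl : BF (n + 1) :=
    ((((andF (memf x A) (andF φ₁ φ₂)).imp (eqf y y')).all).all).all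
  -- image context `n+4`: parameters, `A = n`, `B = n+1`, `y = n+2`, `x = n+3`
  let xi : Fin (n + 4) := ⟨n + 3, by omega⟩
  let yi : Fin (n + 4) := ⟨n + 2, by omega⟩
  let B3 : Fin (n + 3) := ⟨n + 1, by omega⟩
  let y3 : Fin (n + 3) := ⟨n + 2, by omega⟩
  let φ₃ : BF (n + 4) :=
    reindex (fun i => if h : (i : ℕ) < n then ⟨i, by omega⟩ else if (i : ℕ) = n then xi else yi) φ
  let image : BF (n + 1) :=
    (((iffF (memf y3 B3) ((andF (memf xi A) φ₃).ex)).all).ex)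
  ((funcl.imp image).all).alls

/-- The Axiom of Choice: every set is the surjective image of an ordinal. -/
def acAx : SetLang.Sentence :=
  ((((andF (reindex ![1] ordF) (reindex ![1, 0, 2] isFuncF)).ex).ex).all : BF 0)

/-- `v₀ = ω`: `v₀` is an ordinal containing `∅`, closed under successors, each of whose
elements is `∅` or a successor. -/
def omegaF : BF 1 :=
  andF (andF ordF ((andF (memf 1 0) (reindex ![1] emptyF)).ex))
    (andF (((memf 1 0).imp ((andF (memf 2 0) (reindex ![1, 2] succF)).ex)).all)
      (((memf 1 0).imp
        (orF (reindex ![1] emptyF) ((andF (memf 2 1) (reindex ![2, 1] succF)).ex))).all))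

/-- Given `v₀ = ω`, `v₁ = ℵ₁`: `v₁` is an ordinal, there is no surjection from `ω` onto `v₁`,
and every element of `v₁` is empty or a surjective image of `ω`. -/
def alephOneF : BF 2 :=
  andF (andF (reindex ![1] ordF) (((reindex ![0, 1, 2] isFuncF).ex).not))
    (((memf 2 1).imp (orF (reindex ![2] emptyF) ((reindex ![0, 2, 3] isFuncF).ex))).all)

/-- The Continuum Hypothesis `ℵ₁ = 2^ℵ₀`: there is a bijection between `𝒫(ω)` and `ℵ₁`. -/
def chSent : SetLang.Sentence :=
  (((((andF (andF (reindex ![0] omegaF) (reindex ![0, 1] powF))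
      (andF (reindex ![0, 2] alephOneF) (reindex ![1, 2, 3] bijF))).ex).ex).ex).ex : BF 0)

/-! ### The theories `Z`, `ZF`, `ZC`, `ZFC` -/

/-- The finitely many non-scheme axioms of `ZF`. -/
def zfFin : SetLang.Theory := {extAx, foundAx, pairAx, unionAx, powAx, infAx}

/-- All instances of the Separation scheme. -/
def sepScheme : SetLang.Theory := Set.range fun p : Σ n, BF (n + 1) => sepAx p.2

/-- All instances of the Replacement scheme. -/
def replScheme : SetLang.Theory := Set.range fun p : Σ n, BF (n + 2) => replAx p.2

/-- Zermelo set theory. -/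
def Z : SetLang.Theory := zfFin ∪ sepScheme

/-- Zermelo–Fraenkel set theory. -/
def ZF : SetLang.Theory := Z ∪ replScheme

/-- Zermelo set theory with Choice. -/
def ZC : SetLang.Theory := Z ∪ {acAx}

/-- Zermelo–Fraenkel set theory with Choice. -/
def ZFC : SetLang.Theory := ZF ∪ {acAx}

/-! ### Satisfaction in a set with the true membership relation -/

/-- The `L`-structure on (the elements of) a `ZFSet` `M`, with `∈` interpreted as true
membership. -/
def zfStruct (M : ZFSet) : SetLang.Structure {x : ZFSet // x ∈ M} where
  funMap := fun f _ => f.elim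
  RelMap | .mem => fun v => ((v 0 : {x : ZFSet // x ∈ M}) : ZFSet) ∈ ((v 1 : {x : ZFSet // x ∈ M}) : ZFSet)

/-- `(M, ∈) ⊨ T`: the structure on `M` with true membership satisfies every sentence of `T`. -/
def ZModels (M : ZFSet) (T : SetLang.Theory) : Prop :=
  ∀ φ ∈ T, letI := zfStruct M; Sentence.Realize (M := {x : ZFSet // x ∈ M}) φ

/-- `(M, ∈) ⊨ φ[v₀, …, v_{k-1}]`: satisfaction of the formula `φ` in `M`, with the
(membership-checked) valuation `v` of its free variables. -/
def ZRealize (M : ZFSet) {k : ℕ} (φ : BF k) (v : Fin k → ZFSet) : Prop :=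
  ∀ h : ∀ i, v i ∈ M,
    letI := zfStruct M
    BoundedFormula.Realize (M := {x : ZFSet // x ∈ M}) φ (fun e => e.elim) (fun i => ⟨v i, h i⟩)

/-- `x` is a (von Neumann) ordinal: a transitive set of transitive sets. -/
def IsOrd (x : ZFSet) : Prop := x.IsTransitive ∧ ∀ y ∈ x, ZFSet.IsTransitive y


/-! ### Forcing: names, values, generic extensions -/

/-- The value `val(G, τ)` of a name `τ` under `G`, defined by `∈`-recursion:
`val(G, τ) = { val(G, σ) : ∃ p ∈ G, ⟨σ, p⟩ ∈ τ }`. -/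
noncomputable def zval (G : ZFSet) : ZFSet → ZFSet :=
  (InvImage.wf ZFSet.rank Ordinal.lt_wf).fix fun τ ih =>
    letI : ∀ (n : ℕ) (f : (Fin n → ZFSet) → ZFSet), ZFSet.Definable n f := fun _ _ => Classical.allZFSetDefinable _
    ZFSet.image (fun σ => if h : ZFSet.rank σ < ZFSet.rank τ then ih σ h else ∅)
      (ZFSet.sep (fun σ => ∃ p ∈ G, ZFSet.pair σ p ∈ τ) (ZFSet.sUnion (ZFSet.sUnion τ)))

/-- The generic extension `M[G] = { val(G, τ) : τ ∈ M }`. -/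
noncomputable def genExt (M G : ZFSet) : ZFSet :=
  letI : ∀ (n : ℕ) (f : (Fin n → ZFSet) → ZFSet), ZFSet.Definable n f := fun _ _ => Classical.allZFSetDefinable _
  ZFSet.image (zval G) M

/-- `⟨P, r, one⟩` is a forcing notion belonging to `M`: `r ∈ M` is (the graph of) a preorder
on `P ∈ M` with greatest element `one`. -/
def ForcingNotion (M P r one : ZFSet) : Prop :=
  P ∈ M ∧ r ∈ M ∧ one ∈ P ∧
    (∀ q ∈ r, ∃ a ∈ P, ∃ b ∈ P, q = ZFSet.pair a b) ∧
    (∀ p ∈ P, ZFSet.pair p p ∈ r) ∧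
    (∀ p ∈ P, ∀ q ∈ P, ∀ s ∈ P, ZFSet.pair p q ∈ r → ZFSet.pair q s ∈ r →
      ZFSet.pair p s ∈ r) ∧
    (∀ p ∈ P, ZFSet.pair p one ∈ r)

/-- `D` is a dense subset of the forcing notion `⟨P, r⟩`. -/
def IsDenseIn (r P D : ZFSet) : Prop :=
  D ⊆ P ∧ ∀ p ∈ P, ∃ d ∈ D, ZFSet.pair d p ∈ r

/-- `G` is a filter on `⟨P, r⟩`: upward closed and downward directed. -/
def IsFilterOn (r P G : ZFSet) : Prop :=
  G ⊆ P ∧ (∀ x ∈ G, ∀ y ∈ P, ZFSet.pair x y ∈ r → y ∈ G) ∧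
    (∀ x ∈ G, ∀ y ∈ G, ∃ z ∈ G, ZFSet.pair z x ∈ r ∧ ZFSet.pair z y ∈ r)

/-- `G` is an `M`-generic filter on `⟨P, r⟩`: a filter meeting every dense subset of `P`
that belongs to `M`. -/
def IsGeneric (M r P G : ZFSet) : Prop :=
  IsFilterOn r P G ∧ ∀ D ∈ M, IsDenseIn r P D → ∃ q ∈ G, q ∈ D



/-- Elements of `M` as a type. -/
abbrev El (M : ZFSet) := {x : ZFSet // x ∈ M}

instance instStr (M : ZFSet) : SetLang.Structure (El M) := zfStruct M

theorem rz_mem {M : ZFSet} {α : Type*} {n : ℕ} (t s : SetLang.Term (α ⊕ Fin n)) (e : α → El M)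
    (v : Fin n → El M) :
    (memSymb.boundedFormula₂ t s).Realize e v ↔
      (t.realize (Sum.elim e v)).1 ∈ (s.realize (Sum.elim e v)).1 := by
  rw [BoundedFormula.realize_rel₂]; rfl

theorem rz_memf {M : ZFSet} {n : ℕ} (i j : Fin n) (e : Empty → El M) (v : Fin n → El M) :
    (memf i j).Realize e v ↔ (v i).1 ∈ (v j).1 := by
  unfold memf; rw [rz_mem]; rfl

theorem rz_eqf {M : ZFSet} {n : ℕ} (i j : Fin n) (e : Empty → El M) (v : Fin n → El M) :
    (eqf i j).Realize e v ↔ v i = v j := by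
  unfold eqf; rw [BoundedFormula.realize_bdEqual]; rfl

theorem rz_reindex {M : ZFSet} {m k : ℕ} (f : Fin m → Fin k) (φ : BF m) (e : Empty → El M)
    (v : Fin k → El M) :
    (reindex f φ).Realize e v ↔ φ.Realize e (fun i => v (f i)) := by
  unfold reindex
  have := BoundedFormula.realize_relabel (M := El M) (φ := φ.toFormula) (g := Sum.map id f)
    (v := e) (xs := v)
  refine this.trans ?_
  have h2 := BoundedFormula.realize_toFormula (M := El M) φ
    (Sum.elim e (v ∘ Fin.castAdd 0) ∘ Sum.map id f)
  rw [Formula.Realize] at h2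
  have e1 : (v ∘ Fin.natAdd k : Fin 0 → El M) = default := Subsingleton.elim _ _
  rw [e1, h2]
  rfl

theorem rz_andF {M : ZFSet} {n : ℕ} (φ ψ : BF n) (e : Empty → El M) (v : Fin n → El M) :
    (andF φ ψ).Realize e v ↔ φ.Realize e v ∧ ψ.Realize e v := by
  simp [andF]

theorem rz_orF {M : ZFSet} {n : ℕ} (φ ψ : BF n) (e : Empty → El M) (v : Fin n → El M) :
    (orF φ ψ).Realize e v ↔ φ.Realize e v ∨ ψ.Realize e v := by
  simp [orF]; tauto

theorem rz_iffF {M : ZFSet} {n : ℕ} (φ ψ : BF n) (e : Empty → El M) (v : Fin n → El M) :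
    (iffF φ ψ).Realize e v ↔ (φ.Realize e v ↔ ψ.Realize e v) := by
  simp [iffF, rz_andF]; tauto

/-- Definable with parameters over `M`. -/
def D {M : ZFSet} {n : ℕ} (R : (Fin n → El M) → Prop) : Prop :=
  ∃ φ : SetLang.BoundedFormula (El M) n, ∀ v, φ.Realize id v ↔ R v

section
variable {M : ZFSet} {n : ℕ}

theorem D.congr {R S : (Fin n → El M) → Prop} (h : D R) (hh : ∀ v, S v ↔ R v) : D S := by
  have : S = R := funext fun v => propext (hh v)
  rw [this]; exact h

theorem D_not {R : (Fin n → El M) → Prop} (h : D R) : D (fun v => ¬ R v) := by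
  obtain ⟨φ, h⟩ := h
  exact ⟨φ.not, fun v => by simp [h]⟩

theorem D_imp {R S : (Fin n → El M) → Prop} (h : D R) (h' : D S) : D (fun v => R v → S v) := by
  obtain ⟨φ, h⟩ := h
  obtain ⟨ψ, h'⟩ := h'
  exact ⟨φ.imp ψ, fun v => by simp [h, h']⟩

theorem D_and {R S : (Fin n → El M) → Prop} (h : D R) (h' : D S) : D (fun v => R v ∧ S v) :=
  (D_not (D_imp h (D_not h'))).congr fun v => by simp

theorem D_or {R S : (Fin n → El M) → Prop} (h : D R) (h' : D S) : D (fun v => R v ∨ S v) :=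
  (D_imp (D_not h) h').congr fun v => by tauto

theorem D_iff {R S : (Fin n → El M) → Prop} (h : D R) (h' : D S) : D (fun v => R v ↔ S v) :=
  (D_and (D_imp h h') (D_imp h' h)).congr fun v => by tauto

theorem D_all {R : (Fin n → El M) → El M → Prop}
    (h : D (fun w : Fin (n+1) → El M => R (Fin.init w) (w (Fin.last n)))) :
    D (fun v => ∀ x, R v x) := by
  obtain ⟨φ, h⟩ := h
  refine ⟨φ.all, fun v => ?_⟩
  simp only [BoundedFormula.realize_all, h, Fin.init_snoc, Fin.snoc_last]

theorem D_ex {R : (Fin n → El M) → El M → Prop}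
    (h : D (fun w : Fin (n+1) → El M => R (Fin.init w) (w (Fin.last n)))) :
    D (fun v => ∃ x, R v x) := by
  obtain ⟨φ, h⟩ := h
  refine ⟨φ.ex, fun v => ?_⟩
  simp only [BoundedFormula.realize_ex, h, Fin.init_snoc, Fin.snoc_last]

/-- Variables or constants. -/
def DT (t : (Fin n → El M) → El M) : Prop :=
  ∃ s : El M ⊕ Fin n, ∀ v, t v = Sum.elim id v s

theorem DT_var (i : Fin n) : DT (fun v : Fin n → El M => v i) := ⟨Sum.inr i, fun _ => rfl⟩

theorem DT_const (c : El M) : DT (fun _ : Fin n → El M => c) := ⟨Sum.inl c, fun _ => rfl⟩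

theorem D_memT {s t : (Fin n → El M) → El M} (hs : DT s) (ht : DT t) :
    D (fun v => (s v).1 ∈ (t v).1) := by
  obtain ⟨a, ha⟩ := hs
  obtain ⟨b, hb⟩ := ht
  refine ⟨memSymb.boundedFormula₂ (Term.var a) (Term.var b), fun v => ?_⟩
  beta_reduce; rw [rz_mem, ha, hb]; rfl

theorem D_eqT {s t : (Fin n → El M) → El M} (hs : DT s) (ht : DT t) :
    D (fun v => s v = t v) := by
  obtain ⟨a, ha⟩ := hs
  obtain ⟨b, hb⟩ := ht
  refine ⟨Term.bdEqual (Term.var a) (Term.var b), fun v => ?_⟩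
  beta_reduce; rw [BoundedFormula.realize_bdEqual, ha, hb]; rfl

theorem D_subst {m : ℕ} {R : (Fin m → El M) → Prop} (h : D R)
    {t : (Fin n → El M) → (Fin m → El M)} (ht : ∀ i, DT (fun v => t v i)) :
    D (fun v => R (t v)) := by
  obtain ⟨φ, h⟩ := h
  choose s hs using ht
  refine ⟨(BoundedFormula.relabel (Sum.elim Sum.inl s) φ.toFormula :
    SetLang.BoundedFormula (El M) (n + 0)), fun v => ?_⟩
  have := BoundedFormula.realize_relabel (M := El M) (φ := φ.toFormula)
    (g := (Sum.elim Sum.inl s : El M ⊕ Fin m → El M ⊕ Fin n)) (v := id) (xs := v)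
  refine this.trans ?_
  have h2 := BoundedFormula.realize_toFormula (M := El M) φ
    (Sum.elim id (v ∘ Fin.castAdd 0) ∘ Sum.elim Sum.inl s)
  rw [Formula.Realize] at h2
  have e1 : (v ∘ Fin.natAdd n : Fin 0 → El M) = default := Subsingleton.elim _ _
  beta_reduce; rw [e1, h2, ← h]
  have : t v = (fun i => Sum.elim id v (s i)) := funext fun i => hs i v
  rw [this]
  rfl

theorem D_ofBF (φ : BF n) (e : Empty → El M) : D (fun v : Fin n → El M => φ.Realize e v) := by
  refine ⟨(BoundedFormula.relabel (fun x : Empty ⊕ Fin n => (Sum.elim Empty.elim Sum.inr x : El M ⊕ Fin n)) φ.toFormula :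
    SetLang.BoundedFormula (El M) (n + 0)), fun v => ?_⟩
  have := BoundedFormula.realize_relabel (M := El M) (φ := φ.toFormula)
    (g := (fun x : Empty ⊕ Fin n => (Sum.elim Empty.elim Sum.inr x : El M ⊕ Fin n))) (v := id) (xs := v)
  refine this.trans ?_
  have h2 := BoundedFormula.realize_toFormula (M := El M) φ
    (Sum.elim id (v ∘ Fin.castAdd 0) ∘ (fun x : Empty ⊕ Fin n => (Sum.elim Empty.elim Sum.inr x : El M ⊕ Fin n)))
  rw [Formula.Realize] at h2
  have e1 : (v ∘ Fin.natAdd n : Fin 0 → El M) = default := Subsingleton.elim _ _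
  rw [e1, h2]
  have e3 : ((Sum.elim id (v ∘ Fin.castAdd 0) ∘ (fun x : Empty ⊕ Fin n => (Sum.elim Empty.elim Sum.inr x : El M ⊕ Fin n))) ∘ Sum.inl) = e :=
    funext fun x => x.elim
  rw [e3]
  rfl

theorem D_toBF {R : (Fin n → El M) → Prop} (h : D R) (e : Empty → El M) :
    ∃ (k : ℕ) (a : Fin k → El M) (ψ : BF (k + n)), ∀ v, R v ↔ ψ.Realize e (Fin.append a v) := by
  classical
  obtain ⟨φ, h⟩ := h
  let en := φ.freeVarFinset.equivFin
  let φ' : SetLang.BoundedFormula φ.freeVarFinset n := φ.restrictFreeVar id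
  refine ⟨_, fun i => (en.symm i).1, φ'.relabel (fun x => Sum.inr (en x)), fun v => ?_⟩
  rw [BoundedFormula.realize_relabel, ← h]
  have e1 : (Fin.append (fun i => (en.symm i).1) v ∘ Fin.natAdd _ : Fin n → El M) = v := by
    funext i; simp
  rw [e1]
  symm
  apply BoundedFormula.realize_restrictFreeVar
  intro a
  simp [Fin.append_left]

/-- Definable functions. -/
def DF (t : (Fin n → El M) → El M) : Prop :=
  D (fun w : Fin (n+1) → El M => w (Fin.last n) = t (Fin.init w))

theorem DF_var (i : Fin n) : DF (fun v : Fin n → El M => v i) :=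
  D_eqT (DT_var _) (DT_var i.castSucc)

theorem DF_const (c : El M) : DF (fun _ : Fin n → El M => c) :=
  D_eqT (DT_var _) (DT_const c)

theorem D_ap1 {R : El M → Prop} (hR : D (fun w : Fin 1 → El M => R (w 0)))
    {s : (Fin n → El M) → El M} (hs : DF s) : D (fun v => R (s v)) := by
  refine D.congr (D_ex (R := fun v x => x = s v ∧ R x) (D_and hs ?_)) ?_
  · exact D_subst hR (t := fun v _ => v (Fin.last n)) (fun i => DT_var _)
  · intro v; simp

theorem D_ap2 {R : El M → El M → Prop} (hR : D (fun w : Fin 2 → El M => R (w 0) (w 1)))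
    {s t : (Fin n → El M) → El M} (hs : DF s) (ht : DF t) : D (fun v => R (s v) (t v)) := by
  refine D.congr (D_ex (R := fun v x => x = s v ∧ ∃ y, y = t v ∧ R x y) (D_and hs (D_ex (D_and ?_ ?_)))) ?_
  · refine D_subst (R := fun w : Fin (n+1) → El M => w (Fin.last n) = t (Fin.init w)) ht
      (t := fun v => Fin.snoc (Fin.init (Fin.init v)) (v (Fin.last _))) ?_ |>.congr ?_
    · intro i
      refine Fin.lastCases ?_ (fun i => ?_) i
      · simpa using DT_var _
      · simp only [Fin.snoc_castSucc]; exact DT_var _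
    · intro v; simp
  · exact D_subst hR (t := fun v => ![v (Fin.castSucc (Fin.last n)), v (Fin.last _)])
      (fun i => by fin_cases i <;> exact DT_var _)
  · intro v; simp

/-- weakening of definable functions -/
theorem DF_init {t : (Fin n → El M) → El M} (ht : DF t) :
    DF (fun w : Fin (n+1) → El M => t (Fin.init w)) := by
  refine D_subst (R := fun w : Fin (n+1) → El M => w (Fin.last n) = t (Fin.init w)) ht
      (t := fun v => Fin.snoc (Fin.init (Fin.init v)) (v (Fin.last _))) ?_ |>.congr ?_
  · intro i
    refine Fin.lastCases ?_ (fun i => ?_) i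
    · simpa using DT_var _
    · simp only [Fin.snoc_castSucc]; exact DT_var _
  · intro v; simp

theorem D_ap3 {R : El M → El M → El M → Prop}
    (hR : D (fun w : Fin 3 → El M => R (w 0) (w 1) (w 2)))
    {s t u : (Fin n → El M) → El M} (hs : DF s) (ht : DF t) (hu : DF u) :
    D (fun v => R (s v) (t v) (u v)) := by
  refine D.congr (D_ex (R := fun v x => x = s v ∧ ∃ y, y = t v ∧ ∃ z, z = u v ∧ R x y z)
    (D_and hs (D_ex (D_and (DF_init ht) (D_ex (D_and (DF_init (DF_init hu)) ?_)))))) ?_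
  · exact D_subst hR (t := fun v => ![v (Fin.castSucc (Fin.castSucc (Fin.last n))),
      v (Fin.castSucc (Fin.last _)), v (Fin.last _)])
      (fun i => by fin_cases i <;> exact DT_var _)
  · intro v; simp

theorem D_ap4 {R : El M → El M → El M → El M → Prop}
    (hR : D (fun w : Fin 4 → El M => R (w 0) (w 1) (w 2) (w 3)))
    {s t u x : (Fin n → El M) → El M} (hs : DF s) (ht : DF t) (hu : DF u) (hx : DF x) :
    D (fun v => R (s v) (t v) (u v) (x v)) := by
  refine D.congr (D_ex (R := fun v a => a = s v ∧ ∃ y, y = t v ∧ ∃ z, z = u v ∧ ∃ b, b = x v ∧ R a y z b)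
    (D_and hs (D_ex (D_and (DF_init ht) (D_ex (D_and (DF_init (DF_init hu))
      (D_ex (D_and (DF_init (DF_init (DF_init hx))) ?_)))))))) ?_
  · exact D_subst hR (t := fun v => ![v (Fin.castSucc (Fin.castSucc (Fin.castSucc (Fin.last n)))),
      v (Fin.castSucc (Fin.castSucc (Fin.last _))), v (Fin.castSucc (Fin.last _)), v (Fin.last _)])
      (fun i => by fin_cases i <;> exact DT_var _)
  · intro v; simp

theorem D_mem {s t : (Fin n → El M) → El M} (hs : DF s) (ht : DF t) :
    D (fun v => (s v).1 ∈ (t v).1) :=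
  D_ap2 (R := fun x y => x.1 ∈ y.1) (D_memT (DT_var _) (DT_var _)) hs ht

theorem D_eq {s t : (Fin n → El M) → El M} (hs : DF s) (ht : DF t) :
    D (fun v => s v = t v) :=
  D_ap2 (R := fun x y => x = y) (D_eqT (DT_var _) (DT_var _)) hs ht

theorem DT_snoc {m : ℕ} {t : (Fin n → El M) → (Fin m → El M)} (ht : ∀ i, DT (fun v => t v i))
    {s : (Fin n → El M) → El M} (hs : DT s) :
    ∀ i, DT (fun v => (Fin.snoc (t v) (s v) : Fin (m+1) → El M) i) := by
  intro i
  refine Fin.lastCases ?_ (fun i => ?_) i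
  · simpa using hs
  · simpa using ht i

end


/-- Semantic form of the `ZF` axioms. -/
structure Ax (N : ZFSet) : Prop where
  pair : ∀ a b : El N, ∃ c : El N, ∀ x : El N, x.1 ∈ c.1 ↔ x = a ∨ x = b
  union : ∀ a : El N, ∃ b : El N, ∀ x : El N, x.1 ∈ b.1 ↔ ∃ y : El N, y.1 ∈ a.1 ∧ x.1 ∈ y.1
  pow : ∀ a : El N, ∃ b : El N, ∀ x : El N, x.1 ∈ b.1 ↔ ∀ z : El N, z.1 ∈ x.1 → z.1 ∈ a.1
  inf : ∃ w : El N, (∃ e : El N, e.1 ∈ w.1 ∧ ∀ z : El N, z.1 ∉ e.1) ∧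
    ∀ x : El N, x.1 ∈ w.1 → ∃ y : El N, y.1 ∈ w.1 ∧ ∀ z : El N, z.1 ∈ y.1 ↔ z.1 ∈ x.1 ∨ z = x
  sep : ∀ R : El N → Prop, D (fun w : Fin 1 → El N => R (w 0)) → ∀ A : El N, ∃ B : El N,
    ∀ x : El N, x.1 ∈ B.1 ↔ x.1 ∈ A.1 ∧ R x
  repl : ∀ R : El N → El N → Prop, D (fun w : Fin 2 → El N => R (w 0) (w 1)) → ∀ A : El N,
    (∀ x : El N, x.1 ∈ A.1 → ∀ y y', R x y → R x y' → y = y') →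
    ∃ B : El N, ∀ y : El N, y.1 ∈ B.1 ↔ ∃ x : El N, x.1 ∈ A.1 ∧ R x y

/-- Separation scheme, one formula. -/
def SepS (N : ZFSet) : Prop := ∀ (n : ℕ) (φ : BF (n+1)) (v : Fin n → El N) (A : El N),
  ∃ B : El N, ∀ x : El N, x.1 ∈ B.1 ↔ x.1 ∈ A.1 ∧
    φ.Realize (default : Empty → El N) (Fin.snoc v x : Fin (n+1) → El N)

def ReplS (N : ZFSet) : Prop := ∀ (n : ℕ) (φ : BF (n+2)) (v : Fin n → El N) (A : El N),
    (∀ x : El N, x.1 ∈ A.1 → ∀ y y' : El N,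
      φ.Realize (default : Empty → El N) (Fin.snoc (Fin.snoc v x : Fin (n+1) → El N) y : Fin (n+2) → El N) →
      φ.Realize (default : Empty → El N) (Fin.snoc (Fin.snoc v x : Fin (n+1) → El N) y' : Fin (n+2) → El N) → y = y') →
    ∃ B : El N, ∀ y : El N, y.1 ∈ B.1 ↔ ∃ x : El N, x.1 ∈ A.1 ∧
      φ.Realize (default : Empty → El N) (Fin.snoc (Fin.snoc v x : Fin (n+1) → El N) y : Fin (n+2) → El N)

section
variable {N : ZFSet}

theorem rz_sepAx {n : ℕ} (φ : BF (n+1)) : Sentence.Realize (M := El N) (sepAx φ) ↔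
    ∀ (v : Fin n → El N) (A : El N),
  ∃ B : El N, ∀ x : El N, x.1 ∈ B.1 ↔ x.1 ∈ A.1 ∧
    φ.Realize (default : Empty → El N) (Fin.snoc v x : Fin (n+1) → El N) := by
  unfold sepAx Sentence.Realize
  simp only [BoundedFormula.realize_alls, BoundedFormula.realize_all, BoundedFormula.realize_ex,
    rz_iffF, rz_andF, rz_memf, rz_reindex]
  refine forall_congr' fun v => forall_congr' fun A => exists_congr fun B => forall_congr' fun x => ?_
  have h : (fun i : Fin (n+1) => (Fin.snoc (Fin.snoc (Fin.snoc v A : Fin (n+1) → El N) B : Fin (n+2) → El N) x : Fin (n+3) → El N)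
      (if h : (i : ℕ) < n then ⟨i, by omega⟩ else ⟨n+2, by omega⟩)) = (Fin.snoc v x : Fin (n+1) → El N) := by
    funext i
    by_cases hi : (i : ℕ) < n
    · simp [hi, hi.le, Fin.snoc, show (i:ℕ) < n + 2 by omega]
    · simp [hi, Fin.snoc]
  rw [h]
  have h1 : ∀ h, (Fin.snoc (Fin.snoc (Fin.snoc v A : Fin (n+1) → El N) B : Fin (n+2) → El N) x : Fin (n+3) → El N) ⟨n, h⟩ = A := by
    intro h; simp [Fin.snoc]
  have h2 : ∀ h, (Fin.snoc (Fin.snoc (Fin.snoc v A : Fin (n+1) → El N) B : Fin (n+2) → El N) x : Fin (n+3) → El N) ⟨n+1, h⟩ = B := by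
    intro h; simp [Fin.snoc]
  have h3 : ∀ h, (Fin.snoc (Fin.snoc (Fin.snoc v A : Fin (n+1) → El N) B : Fin (n+2) → El N) x : Fin (n+3) → El N) ⟨n+2, h⟩ = x := by
    intro h; simp [Fin.snoc]
  rw [h1, h2, h3]

theorem rz_replAx {n : ℕ} (φ : BF (n+2)) : Sentence.Realize (M := El N) (replAx φ) ↔
    ∀ (v : Fin n → El N) (A : El N),
    (∀ x : El N, x.1 ∈ A.1 → ∀ y y' : El N,
      φ.Realize (default : Empty → El N) (Fin.snoc (Fin.snoc v x : Fin (n+1) → El N) y : Fin (n+2) → El N) →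
      φ.Realize (default : Empty → El N) (Fin.snoc (Fin.snoc v x : Fin (n+1) → El N) y' : Fin (n+2) → El N) → y = y') →
    ∃ B : El N, ∀ y : El N, y.1 ∈ B.1 ↔ ∃ x : El N, x.1 ∈ A.1 ∧
      φ.Realize (default : Empty → El N) (Fin.snoc (Fin.snoc v x : Fin (n+1) → El N) y : Fin (n+2) → El N) := by
  unfold replAx Sentence.Realize
  simp only [BoundedFormula.realize_alls, BoundedFormula.realize_all, BoundedFormula.realize_ex,
    BoundedFormula.realize_imp, rz_iffF, rz_andF, rz_memf, rz_reindex, rz_eqf]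
  have h4 : ∀ (v : Fin n → El N) (a b c d : El N),
     ∀ h, (Fin.snoc (Fin.snoc (Fin.snoc (Fin.snoc v a : Fin (n+1) → El N) b : Fin (n+2) → El N) c : Fin (n+3) → El N) d : Fin (n+4) → El N) ⟨n, h⟩ = a := by
    intros; simp [Fin.snoc]
  have h5 : ∀ (v : Fin n → El N) (a b c d : El N),
     ∀ h, (Fin.snoc (Fin.snoc (Fin.snoc (Fin.snoc v a : Fin (n+1) → El N) b : Fin (n+2) → El N) c : Fin (n+3) → El N) d : Fin (n+4) → El N) ⟨n+1, h⟩ = b := by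
    intros; simp [Fin.snoc]
  have h6 : ∀ (v : Fin n → El N) (a b c d : El N),
     ∀ h, (Fin.snoc (Fin.snoc (Fin.snoc (Fin.snoc v a : Fin (n+1) → El N) b : Fin (n+2) → El N) c : Fin (n+3) → El N) d : Fin (n+4) → El N) ⟨n+2, h⟩ = c := by
    intros; simp [Fin.snoc]
  have h7 : ∀ (v : Fin n → El N) (a b c d : El N),
     ∀ h, (Fin.snoc (Fin.snoc (Fin.snoc (Fin.snoc v a : Fin (n+1) → El N) b : Fin (n+2) → El N) c : Fin (n+3) → El N) d : Fin (n+4) → El N) ⟨n+3, h⟩ = d := by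
    intros; simp [Fin.snoc]
  have h2 : ∀ (v : Fin n → El N) (a b c : El N), ∀ h, (Fin.snoc (Fin.snoc (Fin.snoc v a : Fin (n+1) → El N) b : Fin (n+2) → El N) c : Fin (n+3) → El N) ⟨n+1, h⟩ = b := by
    intros; simp [Fin.snoc]
  have h3 : ∀ (v : Fin n → El N) (a b c : El N), ∀ h, (Fin.snoc (Fin.snoc (Fin.snoc v a : Fin (n+1) → El N) b : Fin (n+2) → El N) c : Fin (n+3) → El N) ⟨n+2, h⟩ = c := by
    intros; simp [Fin.snoc]
  have key : ∀ (v : Fin n → El N) (a b c d : El N) (p q : Fin (n+4)) (hp : ∀ i : Fin (n+2), (i : ℕ) < n → (i : ℕ) < n + 4),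
     (fun i : Fin (n+2) => (Fin.snoc (Fin.snoc (Fin.snoc (Fin.snoc v a : Fin (n+1) → El N) b : Fin (n+2) → El N) c : Fin (n+3) → El N) d : Fin (n+4) → El N)
       (if h : (i : ℕ) < n then ⟨i, hp i h⟩ else if (i : ℕ) = n then p else q)) =
      (Fin.snoc (Fin.snoc v ((Fin.snoc (Fin.snoc (Fin.snoc (Fin.snoc v a : Fin (n+1) → El N) b : Fin (n+2) → El N) c : Fin (n+3) → El N) d : Fin (n+4) → El N) p) : Fin (n+1) → El N)
        ((Fin.snoc (Fin.snoc (Fin.snoc (Fin.snoc v a : Fin (n+1) → El N) b : Fin (n+2) → El N) c : Fin (n+3) → El N) d : Fin (n+4) → El N) q) : Fin (n+2) → El N) := by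
    intro v a b c d p q hp
    generalize hw : (Fin.snoc (Fin.snoc (Fin.snoc (Fin.snoc v a : Fin (n+1) → El N) b : Fin (n+2) → El N) c : Fin (n+3) → El N) d : Fin (n+4) → El N) = w
    funext i
    by_cases hi : (i : ℕ) < n
    · simp only [hi, dite_true]
      have : w ⟨i, hp i hi⟩ = v ⟨i, hi⟩ := by
        rw [← hw]
        simp [Fin.snoc, hi, show (i:ℕ) < n + 1 by omega, show (i:ℕ) < n + 2 by omega, show (i:ℕ) < n + 3 by omega]; rfl
      rw [this]
      simp [Fin.snoc, hi, show (i:ℕ) < n + 1 by omega]; rfl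
    · by_cases hi' : (i : ℕ) = n
      · simp [hi', Fin.snoc]
      · have : (i:ℕ) = n + 1 := by omega
        simp [this, Fin.snoc]
  simp only [key, h4, h5, h6, h7, h2, h3]
  refine forall_congr' fun v => forall_congr' fun A => imp_congr ?_ Iff.rfl
  constructor
  · intro h x hx y y' a b; exact h x y y' ⟨hx, a, b⟩
  · rintro h x y y' ⟨hx, a, b⟩; exact h x hx y y' a b

theorem sepD_of (h : SepS N) (R : El N → Prop) (hR : D (fun w : Fin 1 → El N => R (w 0)))
    (A : El N) : ∃ B : El N, ∀ x : El N, x.1 ∈ B.1 ↔ x.1 ∈ A.1 ∧ R x := by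
  obtain ⟨k, a, ψ, hψ⟩ := D_toBF hR default
  obtain ⟨B, hB⟩ := h k ψ a A
  refine ⟨B, fun x => (hB x).trans ?_⟩
  have := hψ (fun _ => x)
  rw [Fin.append_right_eq_snoc] at this
  rw [← this]

theorem replD_of (h : ReplS N) (R : El N → El N → Prop)
    (hR : D (fun w : Fin 2 → El N => R (w 0) (w 1)))
    (A : El N) (hf : ∀ x : El N, x.1 ∈ A.1 → ∀ y y', R x y → R x y' → y = y') :
    ∃ B : El N, ∀ y : El N, y.1 ∈ B.1 ↔ ∃ x : El N, x.1 ∈ A.1 ∧ R x y := by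
  obtain ⟨k, a, ψ, hψ⟩ := D_toBF hR default
  have key : ∀ x y, R x y ↔ ψ.Realize (default : Empty → El N) (Fin.snoc (Fin.snoc a x : Fin (k+1) → El N) y : Fin (k+2) → El N) := by
    intro x y
    have := hψ ![x, y]
    have e : Fin.append a ![x, y] = (Fin.snoc (Fin.snoc a x : Fin (k+1) → El N) y : Fin (k+2) → El N) := by
      rw [← Fin.append_right_eq_snoc (Fin.snoc a x : Fin (k+1) → El N) (fun _ => y), ← Fin.append_right_eq_snoc a (fun _ => x)]
      funext i
      refine Fin.addCases (fun i => ?_) (fun i => ?_) i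
      · rw [Fin.append_left]
        have e3 : Fin.castAdd 2 i = Fin.castAdd 1 (Fin.castAdd 1 i) := rfl
        rw [e3, Fin.append_left, Fin.append_left]
      · rw [Fin.append_right]
        fin_cases i
        · have e3 : Fin.natAdd k (0 : Fin 2) = Fin.castAdd 1 (Fin.natAdd k (0 : Fin 1)) := rfl
          simp only [Fin.zero_eta]
          rw [e3, Fin.append_left, Fin.append_right]; rfl
        · have e3 : Fin.natAdd k (1 : Fin 2) = Fin.natAdd (k+1) (0 : Fin 1) := rfl
          simp only [Fin.mk_one]
          rw [e3, Fin.append_right]; rfl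
    rw [e] at this
    exact this
  have := h k ψ a A
  simp only [← key] at this
  exact this hf

theorem mem_ZF_sep {n : ℕ} (φ : BF (n+1)) : sepAx φ ∈ ZF := Or.inl (Or.inr ⟨⟨n, φ⟩, rfl⟩)
theorem mem_ZF_repl {n : ℕ} (φ : BF (n+2)) : replAx φ ∈ ZF := Or.inr ⟨⟨n, φ⟩, rfl⟩

theorem rz_pairSetF (e : Empty → El N) (v : Fin 3 → El N) : pairSetF.Realize e v ↔
   ∀ x : El N, x.1 ∈ (v 2).1 ↔ x = v 0 ∨ x = v 1 := by
  unfold pairSetF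
  simp only [BoundedFormula.realize_all, rz_iffF, rz_orF, rz_memf, rz_eqf]
  rfl

theorem rz_pairAx : Sentence.Realize (M := El N) pairAx ↔
    ∀ a b : El N, ∃ c : El N, ∀ x : El N, x.1 ∈ c.1 ↔ x = a ∨ x = b := by
  unfold pairAx Sentence.Realize Formula.Realize
  simp only [BoundedFormula.realize_all, BoundedFormula.realize_ex, rz_pairSetF]
  rfl

theorem rz_unionAx : Sentence.Realize (M := El N) unionAx ↔
  ∀ a : El N, ∃ b : El N, ∀ x : El N, x.1 ∈ b.1 ↔ ∃ y : El N, y.1 ∈ a.1 ∧ x.1 ∈ y.1 := by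
  unfold unionAx Sentence.Realize Formula.Realize
  simp only [BoundedFormula.realize_all, BoundedFormula.realize_ex, rz_iffF, rz_andF, rz_memf]
  rfl

theorem rz_subF (e : Empty → El N) (v : Fin 2 → El N) : subF.Realize e v ↔
   ∀ x : El N, x.1 ∈ (v 0).1 → x.1 ∈ (v 1).1 := by
  unfold subF
  simp only [BoundedFormula.realize_all, BoundedFormula.realize_imp, rz_memf]
  rfl

theorem rz_powAx : Sentence.Realize (M := El N) powAx ↔
  ∀ a : El N, ∃ b : El N, ∀ x : El N, x.1 ∈ b.1 ↔ ∀ z : El N, z.1 ∈ x.1 → z.1 ∈ a.1 := by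
  unfold powAx powF Sentence.Realize Formula.Realize
  simp only [BoundedFormula.realize_all, BoundedFormula.realize_ex, rz_iffF, rz_memf, rz_reindex, rz_subF]
  rfl

theorem rz_infAx : Sentence.Realize (M := El N) infAx ↔
  ∃ w : El N, (∃ e : El N, e.1 ∈ w.1 ∧ ∀ z : El N, z.1 ∉ e.1) ∧
    ∀ x : El N, x.1 ∈ w.1 → ∃ y : El N, y.1 ∈ w.1 ∧ ∀ z : El N, z.1 ∈ y.1 ↔ z.1 ∈ x.1 ∨ z = x := by
  unfold infAx succF emptyF Sentence.Realize Formula.Realize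
  simp only [BoundedFormula.realize_all, BoundedFormula.realize_ex, BoundedFormula.realize_imp, BoundedFormula.realize_not,
    rz_iffF, rz_andF, rz_orF, rz_memf, rz_reindex, rz_eqf]
  rfl

theorem rz_extAx (tr : N.IsTransitive) : Sentence.Realize (M := El N) extAx := by
  unfold extAx Sentence.Realize Formula.Realize
  simp only [BoundedFormula.realize_all, BoundedFormula.realize_imp,
    rz_andF, rz_reindex, rz_eqf, rz_subF]
  rintro a b ⟨h1, h2⟩
  apply Subtype.ext
  apply ZFSet.ext
  intro z
  exact ⟨fun h => h1 ⟨z, tr.mem_trans h a.2⟩ h, fun h => h2 ⟨z, tr.mem_trans h b.2⟩ h⟩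

theorem rz_foundAx : Sentence.Realize (M := El N) foundAx := by
  unfold foundAx Sentence.Realize Formula.Realize
  simp only [BoundedFormula.realize_all, BoundedFormula.realize_ex, BoundedFormula.realize_imp, BoundedFormula.realize_not,
    rz_andF, rz_memf]
  intro a
  change (∃ x : El N, x.1 ∈ a.1) → ∃ x : El N, x.1 ∈ a.1 ∧ ∀ y : El N, y.1 ∈ a.1 → y.1 ∉ x.1
  rintro ⟨x, hx⟩
  have := (InvImage.wf (fun x : El N => x.1) ZFSet.mem_wf).has_min {x : El N | x.1 ∈ a.1} ⟨x, hx⟩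
  obtain ⟨m, hm, h⟩ := this
  exact ⟨m, hm, fun y hy hh => h y hy hh⟩

theorem Ax_of_models (h : ZModels N ZF) : Ax N where
  pair := rz_pairAx.1 (h _ (Or.inl (Or.inl (by simp [zfFin]))))
  union := rz_unionAx.1 (h _ (Or.inl (Or.inl (by simp [zfFin]))))
  pow := rz_powAx.1 (h _ (Or.inl (Or.inl (by simp [zfFin]))))
  inf := rz_infAx.1 (h _ (Or.inl (Or.inl (by simp [zfFin]))))
  sep := sepD_of fun _ φ => (rz_sepAx φ).1 (h _ (mem_ZF_sep φ))
  repl := replD_of fun _ φ => (rz_replAx φ).1 (h _ (mem_ZF_repl φ))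

theorem D_bf1 {n : ℕ} (φ : BF (n+1)) (v : Fin n → El N) :
   D (fun w : Fin 1 → El N => φ.Realize (default : Empty → El N) (Fin.snoc v (w 0) : Fin (n+1) → El N)) :=
  D_subst (D_ofBF φ default) (t := fun w : Fin 1 → El N => (Fin.snoc v (w 0) : Fin (n+1) → El N))
    (DT_snoc (t := fun _ => v) (fun _ => DT_const _) (DT_var 0))

theorem D_bf2 {n : ℕ} (φ : BF (n+2)) (v : Fin n → El N) :
   D (fun w : Fin 2 → El N => φ.Realize (default : Empty → El N) (Fin.snoc (Fin.snoc v (w 0) : Fin (n+1) → El N) (w 1) : Fin (n+2) → El N)) :=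
  D_subst (D_ofBF φ default) (t := fun w : Fin 2 → El N => (Fin.snoc (Fin.snoc v (w 0) : Fin (n+1) → El N) (w 1) : Fin (n+2) → El N))
    (DT_snoc (DT_snoc (t := fun _ => v) (fun _ => DT_const _) (DT_var 0)) (DT_var 1))

theorem models_of_Ax (tr : N.IsTransitive) (h : Ax N) : ZModels N ZF := by
  intro φ hφ
  change Sentence.Realize (M := El N) φ
  rcases hφ with (hφ | ⟨⟨n, ψ⟩, rfl⟩) | ⟨⟨n, ψ⟩, rfl⟩
  · rcases hφ with rfl | rfl | rfl | rfl | rfl | rfl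
    · exact rz_extAx tr
    · exact rz_foundAx
    · exact rz_pairAx.2 h.pair
    · exact rz_unionAx.2 h.union
    · exact rz_powAx.2 h.pow
    · exact rz_infAx.2 h.inf
  · exact (rz_sepAx ψ).2 fun v A => h.sep _ (D_bf1 ψ v) A
  · exact (rz_replAx ψ).2 fun v A => h.repl _ (D_bf2 ψ v) A

end


/-- Transitive models. -/
structure TM (M : ZFSet) : Prop where
  tr : M.IsTransitive
  ax : Ax M

section
variable {M : ZFSet} (H : TM M)
include H

theorem TM.mem {x : ZFSet} {y : El M} (h : x ∈ y.1) : x ∈ M := H.tr.mem_trans h y.2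

theorem TM.ext {x y : El M} (h : ∀ z : El M, z.1 ∈ x.1 ↔ z.1 ∈ y.1) : x = y := by
  apply Subtype.ext
  apply ZFSet.ext
  intro z
  exact ⟨fun hz => (h ⟨z, H.mem hz⟩).1 hz, fun hz => (h ⟨z, H.mem hz⟩).2 hz⟩

theorem TM.upair (a b : El M) : ({a.1, b.1} : ZFSet) ∈ M := by
  obtain ⟨c, hc⟩ := H.ax.pair a b
  have : ({a.1, b.1} : ZFSet) = c.1 := by
    apply ZFSet.ext
    intro z
    constructor
    · intro hz
      rcases ZFSet.mem_pair.1 hz with rfl | rfl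
      · exact (hc a).2 (Or.inl rfl)
      · exact (hc b).2 (Or.inr rfl)
    · intro hz
      rcases (hc ⟨z, H.mem hz⟩).1 hz with h | h
      · exact ZFSet.mem_pair.2 (Or.inl (congrArg Subtype.val h))
      · exact ZFSet.mem_pair.2 (Or.inr (congrArg Subtype.val h))
  rw [this]; exact c.2

theorem TM.sing (a : El M) : ({a.1} : ZFSet) ∈ M := by
  have := H.upair a a
  simpa using this

theorem TM.opair (a b : El M) : ZFSet.pair a.1 b.1 ∈ M :=
  H.upair ⟨_, H.sing a⟩ ⟨_, H.upair a b⟩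

theorem TM.sU (a : El M) : ZFSet.sUnion a.1 ∈ M := by
  obtain ⟨c, hc⟩ := H.ax.union a
  have : ZFSet.sUnion a.1 = c.1 := by
    apply ZFSet.ext
    intro z
    rw [ZFSet.mem_sUnion]
    constructor
    · rintro ⟨y, hy, hz⟩
      have hy' := H.mem hy
      exact (hc ⟨z, H.tr.mem_trans hz hy'⟩).2 ⟨⟨y, hy'⟩, hy, hz⟩
    · intro hz
      obtain ⟨y, hy, h⟩ := (hc ⟨z, H.mem hz⟩).1 hz
      exact ⟨y.1, hy, h⟩
  rw [this]; exact c.2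

theorem TM.union (a b : El M) : a.1 ∪ b.1 ∈ M := H.sU ⟨_, H.upair a b⟩

theorem TM.left {x y : ZFSet} (h : ZFSet.pair x y ∈ M) : x ∈ M :=
  H.tr.mem_trans (show x ∈ ({x} : ZFSet) by simp) (H.tr.mem_trans (by simp [ZFSet.pair]) h)

theorem TM.right {x y : ZFSet} (h : ZFSet.pair x y ∈ M) : y ∈ M :=
  H.tr.mem_trans (show y ∈ ({x, y} : ZFSet) by simp) (H.tr.mem_trans (by simp [ZFSet.pair]) h)

/-- ordered pair in `M` -/
def mp (a b : El M) : El M := ⟨ZFSet.pair a.1 b.1, H.opair a b⟩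

theorem mp_inj {a b c d : El M} (h : mp H a b = mp H c d) : a = c ∧ b = d := by
  have := ZFSet.pair_injective (congrArg Subtype.val h)
  exact ⟨Subtype.ext this.1, Subtype.ext this.2⟩

theorem mp_iff (c a b : El M) : c = mp H a b ↔ ∀ z : El M, z.1 ∈ c.1 ↔
    ((∀ u : El M, u.1 ∈ z.1 ↔ u = a) ∨ (∀ u : El M, u.1 ∈ z.1 ↔ (u = a ∨ u = b))) := by
  have h1 : ∀ z : El M, z.1 = {a.1} ↔ (∀ u : El M, u.1 ∈ z.1 ↔ u = a) := by
    intro z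
    constructor
    · intro h u; rw [h, ZFSet.mem_singleton, Subtype.ext_iff]
    · intro h
      have : z = ⟨_, H.sing a⟩ := H.ext fun u => by
        rw [h u, Subtype.ext_iff]; exact ZFSet.mem_singleton.symm
      rw [this]
  have h2 : ∀ z : El M, z.1 = {a.1, b.1} ↔ (∀ u : El M, u.1 ∈ z.1 ↔ (u = a ∨ u = b)) := by
    intro z
    constructor
    · intro h u; rw [h, ZFSet.mem_pair, Subtype.ext_iff, Subtype.ext_iff]
    · intro h
      have : z = ⟨_, H.upair a b⟩ := H.ext fun u => by
        rw [h u, Subtype.ext_iff, Subtype.ext_iff]; exact ZFSet.mem_pair.symm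
      rw [this]
  simp only [← h1, ← h2]
  constructor
  · rintro rfl z
    simp [mp, ZFSet.pair]
  · intro h
    exact H.ext fun u => by simp [mp, h, ZFSet.pair]

theorem DF_mp {n : ℕ} {s t : (Fin n → El M) → El M} (hs : DF s) (ht : DF t) :
    DF (fun v => mp H (s v) (t v)) := by
  refine D_ap3 (R := fun c a b => c = mp H a b) ?_ (DF_var _) (DF_init hs) (DF_init ht)
  refine D.congr ?_ (fun v => mp_iff H _ _ _)
  repeat' first
    | exact DF_var _
    | exact DF_const _
    | with_reducible apply D_mem
    | with_reducible apply D_eq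
    | with_reducible apply D_and
    | with_reducible apply D_or
    | with_reducible apply D_iff
    | with_reducible apply D_all
    | with_reducible apply D_ex

/-- ordered triple in `M` -/
def tp (a b c : El M) : El M := mp H a (mp H b c)

theorem tp_inj {a b c a' b' c' : El M} (h : tp H a b c = tp H a' b' c') : a = a' ∧ b = b' ∧ c = c' := by
  obtain ⟨h1, h2⟩ := mp_inj H h
  exact ⟨h1, mp_inj H h2⟩

theorem DF_tp {n : ℕ} {s t u : (Fin n → El M) → El M} (hs : DF s) (ht : DF t) (hu : DF u) :
    DF (fun v => tp H (s v) (t v) (u v)) := DF_mp H hs (DF_mp H ht hu)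

theorem TM.pw (a : El M) : ∃ b : El M, ∀ x : El M, x.1 ∈ b.1 ↔ x.1 ⊆ a.1 := by
  obtain ⟨b, hb⟩ := H.ax.pow a
  refine ⟨b, fun x => (hb x).trans ⟨fun h z hz => h ⟨z, H.mem hz⟩ hz, fun h z hz => h hz⟩⟩

theorem TM.prod (a b : El M) : ∃ c : El M, ∀ x : El M, x.1 ∈ c.1 ↔
    ∃ y z : El M, x = mp H y z ∧ y.1 ∈ a.1 ∧ z.1 ∈ b.1 := by
  obtain ⟨p, hp⟩ := H.pw ⟨_, H.union a b⟩
  obtain ⟨q, hq⟩ := H.pw p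
  obtain ⟨c, hc⟩ := H.ax.sep (fun x => ∃ y z : El M, x = mp H y z ∧ y.1 ∈ a.1 ∧ z.1 ∈ b.1) (by
    repeat' first
    | exact DF_var _
    | exact DF_const _
    | with_reducible apply DF_mp
    | with_reducible apply D_mem
    | with_reducible apply D_eq
    | with_reducible apply D_and
    | with_reducible apply D_or
    | with_reducible apply D_iff
    | with_reducible apply D_all
    | with_reducible apply D_ex) q
  refine ⟨c, fun x => (hc x).trans ⟨fun h => h.2, fun h => ⟨?_, h⟩⟩⟩
  obtain ⟨y, z, rfl, hy, hz⟩ := h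
  rw [hq]
  intro w hw
  have hw' := H.mem hw
  rw [show w = (⟨w, hw'⟩ : El M).1 from rfl, hp]
  intro u hu
  simp [mp, ZFSet.pair] at hw
  rcases hw with rfl | rfl
  · simp at hu; subst hu; simp [hy]
  · simp at hu; rcases hu with rfl | rfl <;> simp [hy, hz]

theorem TM.ind {p : El M → Prop} (h : ∀ x : El M, (∀ y : El M, y.1 ∈ x.1 → p y) → p x) (x : El M) : p x :=
  (InvImage.wf (fun x : El M => x.1) ZFSet.mem_wf).induction (C := p) x h

/-- every set is included in a transitive set -/
theorem TM.tc (x : El M) : ∃ A : El M, (∀ u v : El M, u.1 ∈ A.1 → v.1 ∈ u.1 → v.1 ∈ A.1) ∧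
    ∀ u : El M, u.1 ∈ x.1 → u.1 ∈ A.1 := by
  let L : El M → El M → Prop := fun x A => (∀ u v : El M, u.1 ∈ A.1 → v.1 ∈ u.1 → v.1 ∈ A.1) ∧
    (∀ u : El M, u.1 ∈ x.1 → u.1 ∈ A.1) ∧ ∀ B : El M, (∀ u v : El M, u.1 ∈ B.1 → v.1 ∈ u.1 → v.1 ∈ B.1) →
      (∀ u : El M, u.1 ∈ x.1 → u.1 ∈ B.1) → ∀ u : El M, u.1 ∈ A.1 → u.1 ∈ B.1
  suffices h : ∃ A, L x A by
    obtain ⟨A, h1, h2, -⟩ := h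
    exact ⟨A, h1, h2⟩
  have hD : D (fun w : Fin 2 → El M => L (w 0) (w 1)) := by
    dsimp only [L]
    repeat' first
    | exact DF_var _
    | exact DF_const _
    | with_reducible apply D_mem
    | with_reducible apply D_and
    | with_reducible apply D_imp
    | with_reducible apply D_all
  refine H.ind (p := fun x => ∃ A, L x A) ?_ x
  intro x ih
  obtain ⟨S, hS⟩ := H.ax.repl L hD x (by
    intro y hy A B hA hB
    exact H.ext fun z => ⟨hA.2.2 B hB.1 hB.2.1 z, hB.2.2 A hA.1 hA.2.1 z⟩)
  have key : ∀ u : El M, u.1 ∈ x.1 ∪ ZFSet.sUnion S.1 ↔ u.1 ∈ x.1 ∨ ∃ y A : El M, y.1 ∈ x.1 ∧ L y A ∧ u.1 ∈ A.1 := by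
    intro u
    rw [ZFSet.mem_union, ZFSet.mem_sUnion]
    refine or_congr Iff.rfl ⟨?_, ?_⟩
    · rintro ⟨z, hz, hu⟩
      obtain ⟨y, hy, hL⟩ := (hS ⟨z, H.mem hz⟩).1 hz
      exact ⟨y, _, hy, hL, hu⟩
    · rintro ⟨y, A, hy, hL, hu⟩
      exact ⟨A.1, (hS A).2 ⟨y, hy, hL⟩, hu⟩
  refine ⟨⟨_, H.union x ⟨_, H.sU S⟩⟩, ?_, ?_, ?_⟩
  · intro u v hu hv
    have hu := (key u).1 hu
    refine (key v).2 (Or.inr ?_)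
    rcases hu with hu | ⟨y, A, hy, hL, hu⟩
    · obtain ⟨A, hA⟩ := ih u hu
      exact ⟨u, A, hu, hA, hA.2.1 v hv⟩
    · exact ⟨y, A, hy, hL, hL.1 u v hu hv⟩
  · intro u hu
    exact (key u).2 (Or.inl hu)
  · intro B hB hx u hu
    rcases (key u).1 hu with hu | ⟨y, A, hy, hL, hu⟩
    · exact hx u hu
    · exact hL.2.2 B hB (fun v hv => hB y v (hx y hy) hv) u hu

/-- definable monotone local operators on ternary relations -/
structure Op (Φ : (El M → El M → El M → Prop) → El M → El M → El M → Prop) (K : El M) : Prop where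
  mono : ∀ S T : El M → El M → El M → Prop, (∀ x y z, S x y z → T x y z) → ∀ x y z, Φ S x y z → Φ T x y z
  dfn : D (fun w : Fin 4 → El M => Φ (fun x y z => (tp H x y z).1 ∈ (w 0).1) (w 1) (w 2) (w 3))
  loc : ∀ A : El M, (∀ u v : El M, u.1 ∈ A.1 → v.1 ∈ u.1 → v.1 ∈ A.1) → (∀ u : El M, u.1 ∈ K.1 → u.1 ∈ A.1) →
    ∀ T x y z, x.1 ∈ A.1 → y.1 ∈ A.1 → z.1 ∈ A.1 → Φ T x y z →
      Φ (fun x y z => T x y z ∧ x.1 ∈ A.1 ∧ y.1 ∈ A.1 ∧ z.1 ∈ A.1) x y z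

/-- greatest fixed point inside `M` -/
def GF (Φ : (El M → El M → El M → Prop) → El M → El M → El M → Prop) (a b c : El M) : Prop :=
  ∃ t : El M, (∀ x y z : El M, (tp H x y z).1 ∈ t.1 → Φ (fun x y z => (tp H x y z).1 ∈ t.1) x y z) ∧
    (tp H a b c).1 ∈ t.1

variable {Φ : (El M → El M → El M → Prop) → El M → El M → El M → Prop} {K : El M}

theorem D_GF (hΦ : Op H Φ K) : D (fun w : Fin 3 → El M => GF H Φ (w 0) (w 1) (w 2)) := by
  unfold GF
  repeat' first
    | exact DF_var _
    | exact DF_const _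
    | with_reducible apply DF_tp
    | with_reducible apply D_mem
    | with_reducible apply D_and
    | with_reducible apply D_imp
    | with_reducible apply D_all
    | with_reducible apply D_ex
    | refine D_ap4 (R := fun t x y z => Φ (fun x y z => (tp H x y z).1 ∈ t.1) x y z) hΦ.dfn ?_ ?_ ?_ ?_

theorem GF_unf (hΦ : Op H Φ K) {a b c : El M} (h : GF H Φ a b c) : Φ (GF H Φ) a b c := by
  obtain ⟨t, ht, h⟩ := h
  exact hΦ.mono _ _ (fun x y z hx => ⟨t, ht, hx⟩) _ _ _ (ht _ _ _ h)

theorem GF_fold (hΦ : Op H Φ K) {a b c : El M} (h : Φ (GF H Φ) a b c) : GF H Φ a b c := by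
  let X : El M := ⟨_, H.union K ⟨_, H.union ⟨_, H.sing a⟩ ⟨_, H.upair b c⟩⟩⟩
  obtain ⟨A, hA, hX⟩ := H.tc X
  have ha : a.1 ∈ A.1 := hX a (by simp [X])
  have hb : b.1 ∈ A.1 := hX b (by simp [X])
  have hc : c.1 ∈ A.1 := hX c (by simp [X])
  have hK : ∀ u : El M, u.1 ∈ K.1 → u.1 ∈ A.1 := fun u hu => hX u (by simp [X, hu])
  obtain ⟨A2, hA2⟩ := H.prod A A
  obtain ⟨A3, hA3⟩ := H.prod A A2
  obtain ⟨t, ht⟩ := H.ax.sep (fun e => ∃ x y z : El M, e = tp H x y z ∧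
      (GF H Φ x y z ∨ (x = a ∧ y = b ∧ z = c))) (by
    have := D_GF H hΦ
    repeat' first
    | exact DF_var _
    | exact DF_const _
    | with_reducible apply DF_tp
    | with_reducible apply D_mem
    | with_reducible apply D_eq
    | with_reducible apply D_and
    | with_reducible apply D_or
    | with_reducible apply D_ex
    | apply D_ap3 this) A3
  have key : ∀ x y z : El M, (tp H x y z).1 ∈ t.1 ↔ ((GF H Φ x y z ∨ (x = a ∧ y = b ∧ z = c)) ∧
      x.1 ∈ A.1 ∧ y.1 ∈ A.1 ∧ z.1 ∈ A.1) := by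
    intro x y z
    rw [ht, hA3]
    constructor
    · rintro ⟨⟨x', q, h1, hx, hq⟩, x2, y2, z2, h2, h3⟩
      obtain ⟨y', z', rfl, hy, hz⟩ := (hA2 q).1 hq
      obtain ⟨rfl, rfl, rfl⟩ := tp_inj H h1
      obtain ⟨rfl, rfl, rfl⟩ := tp_inj H h2
      exact ⟨h3, hx, hy, hz⟩
    · rintro ⟨h3, hx, hy, hz⟩
      exact ⟨⟨x, _, rfl, hx, (hA2 _).2 ⟨y, z, rfl, hy, hz⟩⟩, x, y, z, rfl, h3⟩
  refine ⟨t, ?_, (key _ _ _).2 ⟨Or.inr ⟨rfl, rfl, rfl⟩, ha, hb, hc⟩⟩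
  intro x y z hxyz
  obtain ⟨h3, hx, hy, hz⟩ := (key _ _ _).1 hxyz
  have h4 : Φ (GF H Φ) x y z := by
    rcases h3 with h3 | ⟨rfl, rfl, rfl⟩
    · exact GF_unf H hΦ h3
    · exact h
  refine hΦ.mono _ _ ?_ _ _ _ (hΦ.loc A hA hK _ _ _ _ hx hy hz h4)
  rintro x y z ⟨h5, h6⟩
  exact (key _ _ _).2 ⟨Or.inl h5, h6⟩

end


section
variable {M : ZFSet} (H : TM M)
include H

theorem TM.trpair {A : El M} (hA : ∀ u v : El M, u.1 ∈ A.1 → v.1 ∈ u.1 → v.1 ∈ A.1)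
    {a b x : El M} (hx : x.1 ∈ A.1) (h : (mp H a b).1 ∈ x.1) : a.1 ∈ A.1 ∧ b.1 ∈ A.1 := by
  have h1 := hA _ _ hx h
  have h2 : (⟨{a.1, b.1}, H.upair a b⟩ : El M).1 ∈ A.1 := hA _ _ h1 (by simp [mp, ZFSet.pair])
  exact ⟨hA _ a h2 (by simp), hA _ b h2 (by simp)⟩

/-- operator for comparison of ranks -/
def RKop (T : El M → El M → El M → Prop) (p x y : El M) : Prop :=
  ∀ x' : El M, x'.1 ∈ x.1 → ∃ y' : El M, y'.1 ∈ y.1 ∧ T p x' y'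

theorem RKop_Op (K : El M) : Op H RKop K where
  mono := by
    intro S T h x y z hh x' hx'
    obtain ⟨y', h1, h2⟩ := hh x' hx'
    exact ⟨y', h1, h _ _ _ h2⟩
  dfn := by
    unfold RKop
    repeat' first
    | exact DF_var _
    | exact DF_const _
    | with_reducible apply DF_tp
    | with_reducible apply D_mem
    | with_reducible apply D_and
    | with_reducible apply D_imp
    | with_reducible apply D_all
    | with_reducible apply D_ex
  loc := by
    intro A hA _ T p x y hp hx hy h x' hx'
    obtain ⟨y', h1, h2⟩ := h x' hx'
    exact ⟨y', h1, h2, hp, hA _ _ hx hx', hA _ _ hy h1⟩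

theorem RK_iff (K x y : El M) : GF H RKop K x y ↔ x.1.rank ≤ y.1.rank := by
  induction x using H.ind generalizing y with
  | h x ih =>
  have e : GF H RKop K x y ↔ RKop (GF H RKop) K x y :=
    ⟨GF_unf H (RKop_Op H K), GF_fold H (RKop_Op H K)⟩
  rw [e, ZFSet.rank_le_iff]
  constructor
  · intro h x' hx'
    obtain ⟨y', h1, h2⟩ := h ⟨x', H.mem hx'⟩ hx'
    rw [ih _ hx'] at h2
    exact ZFSet.lt_rank_iff.2 ⟨y'.1, h1, h2⟩
  · intro h x' hx'
    obtain ⟨y', h1, h2⟩ := ZFSet.lt_rank_iff.1 (h hx')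
    exact ⟨⟨y', H.mem h1⟩, h1, (ih _ hx' _).2 h2⟩

theorem D_RK : D (fun w : Fin 2 → El M => (w 0).1.rank ≤ (w 1).1.rank) := by
  by_cases hM : Nonempty (El M)
  · obtain ⟨K⟩ := hM
    refine D.congr ?_ (fun w => (RK_iff H K (w 0) (w 1)).symm)
    exact D_ap3 (R := GF H RKop) (D_GF H (RKop_Op H K)) (DF_const _) (DF_var _) (DF_var _)
  · exact ⟨⊥, fun v => (hM ⟨v 0⟩).elim⟩

/-- levels of the cumulative hierarchy -/
theorem TM.lev (z : El M) : ∃ c : El M, ∀ y : El M, y.1 ∈ c.1 ↔ y.1.rank ≤ z.1.rank := by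
  have hD := D_RK H
  induction z using H.ind with
  | h z ih =>
  obtain ⟨S, hS⟩ := H.ax.repl (fun z' c => ∀ y : El M, y.1 ∈ c.1 ↔ y.1.rank ≤ z'.1.rank) (by
    repeat' first
    | exact DF_var _
    | exact DF_const _
    | with_reducible apply D_mem
    | with_reducible apply D_iff
    | with_reducible apply D_all
    | refine D_ap2 (R := fun a b : El M => a.1.rank ≤ b.1.rank) hD ?_ ?_) z (by
    intro x hx c c' h h'
    exact H.ext fun u => (h u).trans (h' u).symm)
  obtain ⟨c, hc⟩ := H.pw ⟨_, H.sU S⟩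
  refine ⟨c, fun y => ?_⟩
  rw [hc, ZFSet.rank_le_iff]
  constructor
  · intro h y' hy'
    obtain ⟨s, hs, h1⟩ := ZFSet.mem_sUnion.1 (h hy')
    obtain ⟨z', hz', h2⟩ := (hS ⟨s, H.mem hs⟩).1 hs
    exact ZFSet.lt_rank_iff.2 ⟨z'.1, hz', (h2 ⟨y', H.mem hy'⟩).1 h1⟩
  · intro h y' hy'
    obtain ⟨z', hz', h2⟩ := ZFSet.lt_rank_iff.1 (h hy')
    obtain ⟨c', hc'⟩ := ih ⟨z', H.mem hz'⟩ hz'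
    exact ZFSet.mem_sUnion.2 ⟨c'.1, (hS c').2 ⟨⟨z', H.mem hz'⟩, hz', hc'⟩, (hc' ⟨y', H.mem hy'⟩).2 h2⟩

theorem TM.coll (R : El M → El M → Prop) (hR : D (fun w : Fin 2 → El M => R (w 0) (w 1))) (A : El M) :
    ∃ B : El M, ∀ x : El M, x.1 ∈ A.1 → (∃ y, R x y) → ∃ y : El M, y.1 ∈ B.1 ∧ R x y := by
  have hD := D_RK H
  obtain ⟨S, hS⟩ := H.ax.repl (fun x c => ∃ y : El M, R x y ∧ (∀ y' : El M, R x y' → y.1.rank ≤ y'.1.rank) ∧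
      ∀ u : El M, u.1 ∈ c.1 ↔ u.1.rank ≤ y.1.rank) (by
    repeat' first
    | exact DF_var _
    | exact DF_const _
    | with_reducible apply D_mem
    | with_reducible apply D_and
    | with_reducible apply D_iff
    | with_reducible apply D_imp
    | with_reducible apply D_all
    | with_reducible apply D_ex
    | refine D_ap2 (R := fun a b : El M => a.1.rank ≤ b.1.rank) hD ?_ ?_
    | refine D_ap2 (R := R) hR ?_ ?_) A (by
    rintro x hx c c' ⟨y, h1, h2, h3⟩ ⟨y', h1', h2', h3'⟩
    refine H.ext fun u => ?_
    rw [h3, h3', le_antisymm (h2 _ h1') (h2' _ h1)])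
  refine ⟨⟨_, H.sU S⟩, ?_⟩
  rintro x hx ⟨y0, hy0⟩
  obtain ⟨y, hy, hmin⟩ := (InvImage.wf (fun y : El M => y.1.rank) Ordinal.lt_wf).has_min {y | R x y} ⟨y0, hy0⟩
  obtain ⟨c, hc⟩ := H.lev y
  exact ⟨y, ZFSet.mem_sUnion.2 ⟨c.1, (hS c).2 ⟨x, hx, y, hy, fun y' h => not_lt.1 (hmin y' h), hc⟩,
    (hc y).2 le_rfl⟩, hy⟩

/-- operator for check names -/
def CKop (T : El M → El M → El M → Prop) (p x c : El M) : Prop :=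
  (∀ y : El M, y.1 ∈ x.1 → ∃ d : El M, (mp H d p).1 ∈ c.1 ∧ T p y d) ∧
  (∀ e : El M, e.1 ∈ c.1 → ∃ d y : El M, e = mp H d p ∧ y.1 ∈ x.1 ∧ T p y d)

theorem CKop_Op (K : El M) : Op H (CKop H) K where
  mono := by
    rintro S T h x y z ⟨h1, h2⟩
    refine ⟨fun y hy => ?_, fun e he => ?_⟩
    · obtain ⟨d, h3, h4⟩ := h1 y hy
      exact ⟨d, h3, h _ _ _ h4⟩
    · obtain ⟨d, y, h3, h4, h5⟩ := h2 e he
      exact ⟨d, y, h3, h4, h _ _ _ h5⟩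
  dfn := by
    unfold CKop
    repeat' first
    | exact DF_var _
    | exact DF_const _
    | with_reducible apply DF_tp
    | with_reducible apply DF_mp
    | with_reducible apply D_mem
    | with_reducible apply D_eq
    | with_reducible apply D_and
    | with_reducible apply D_imp
    | with_reducible apply D_all
    | with_reducible apply D_ex
  loc := by
    rintro A hA _ T p x c hp hx hc ⟨h1, h2⟩
    refine ⟨fun y hy => ?_, fun e he => ?_⟩
    · obtain ⟨d, h3, h4⟩ := h1 y hy
      exact ⟨d, h3, h4, hp, hA _ _ hx hy, (H.trpair hA hc h3).1⟩
    · obtain ⟨d, y, rfl, h4, h5⟩ := h2 e he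
      exact ⟨d, y, rfl, h4, h5, hp, hA _ _ hx h4, (H.trpair hA hc he).1⟩

theorem CK_ex (p x : El M) : (∃ c, GF H (CKop H) p x c) ∧
    ∀ c c', GF H (CKop H) p x c → GF H (CKop H) p x c' → c = c' := by
  induction x using H.ind with
  | h x ih =>
  have hD := D_GF H (CKop_Op H p)
  constructor
  · obtain ⟨c, hc⟩ := H.ax.repl (fun y e => ∃ d, e = mp H d p ∧ GF H (CKop H) p y d) (by
      repeat' first
      | exact DF_var _
      | exact DF_const _
      | with_reducible apply DF_mp
      | with_reducible apply D_eq
      | with_reducible apply D_and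
      | with_reducible apply D_ex
      | refine D_ap3 (R := GF H (CKop H)) hD ?_ ?_ ?_) x (by
      rintro y hy _ _ ⟨d, rfl, hd⟩ ⟨d', rfl, hd'⟩
      rw [(ih y hy).2 d d' hd hd'])
    refine ⟨c, GF_fold H (CKop_Op H p) ⟨fun y hy => ?_, fun e he => ?_⟩⟩
    · obtain ⟨d, hd⟩ := (ih y hy).1
      exact ⟨d, (hc _).2 ⟨y, hy, d, rfl, hd⟩, hd⟩
    · obtain ⟨y, hy, d, he, hd⟩ := (hc e).1 he
      exact ⟨d, y, he, hy, hd⟩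
  · have : ∀ c c', GF H (CKop H) p x c → GF H (CKop H) p x c' → ∀ e : El M, e.1 ∈ c.1 → e.1 ∈ c'.1 := by
      intro c c' h h' e he
      obtain ⟨d, y, rfl, hy, hd⟩ := (GF_unf H (CKop_Op H p) h).2 e he
      obtain ⟨d', h1, hd'⟩ := (GF_unf H (CKop_Op H p) h').1 y hy
      rw [(ih y hy).2 d d' hd hd']; exact h1
    exact fun c c' h h' => H.ext fun e => ⟨this c c' h h' e, this c' c h' h e⟩

end

theorem mem_zval (G τ x : ZFSet) : x ∈ zval G τ ↔ ∃ σ p, p ∈ G ∧ ZFSet.pair σ p ∈ τ ∧ x = zval G σ := by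
  letI : ∀ (n : ℕ) (f : (Fin n → ZFSet) → ZFSet), ZFSet.Definable n f := fun _ _ => Classical.allZFSetDefinable _
  have hr : ∀ σ p, ZFSet.pair σ p ∈ τ → σ.rank < τ.rank := by
    intro σ p h
    refine lt_trans ?_ (ZFSet.rank_lt_of_mem h)
    refine lt_trans (ZFSet.rank_lt_of_mem (y := σ) (x := {σ}) (by simp)) (ZFSet.rank_lt_of_mem (by simp [ZFSet.pair]))
  have e := (InvImage.wf ZFSet.rank Ordinal.lt_wf).fix_eq (fun (τ : ZFSet) (ih : ∀ σ : ZFSet, σ.rank < τ.rank → ZFSet) =>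
    letI : ∀ (n : ℕ) (f : (Fin n → ZFSet) → ZFSet), ZFSet.Definable n f := fun _ _ => Classical.allZFSetDefinable _
    ZFSet.image (fun σ => if h : ZFSet.rank σ < ZFSet.rank τ then ih σ h else ∅)
      (ZFSet.sep (fun σ => ∃ p ∈ G, ZFSet.pair σ p ∈ τ) (ZFSet.sUnion (ZFSet.sUnion τ)))) τ
  change zval G τ = _ at e
  rw [e, ZFSet.mem_image]
  constructor
  · rintro ⟨σ, h, rfl⟩
    obtain ⟨-, p, hp, h⟩ := ZFSet.mem_sep.1 h
    exact ⟨σ, p, hp, h, dif_pos (hr _ _ h)⟩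
  · rintro ⟨σ, p, hp, h, rfl⟩
    refine ⟨σ, ZFSet.mem_sep.2 ⟨?_, p, hp, h⟩, dif_pos (hr _ _ h)⟩
    refine ZFSet.mem_sUnion.2 ⟨{σ}, ZFSet.mem_sUnion.2 ⟨_, h, by simp [ZFSet.pair]⟩, by simp⟩

theorem mem_genExt (M G x : ZFSet) : x ∈ genExt M G ↔ ∃ τ ∈ M, zval G τ = x := by
  letI : ∀ (n : ℕ) (f : (Fin n → ZFSet) → ZFSet), ZFSet.Definable n f := fun _ _ => Classical.allZFSetDefinable _
  exact ZFSet.mem_image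


/-- forcing setup -/
structure FS {M : ZFSet} (H : TM M) (P r one : El M) (G : ZFSet) : Prop where
  oneP : one.1 ∈ P.1
  rP : ∀ q p : El M, (mp H q p).1 ∈ r.1 → q.1 ∈ P.1 ∧ p.1 ∈ P.1
  refl : ∀ p : El M, p.1 ∈ P.1 → (mp H p p).1 ∈ r.1
  trans : ∀ p q s : El M, (mp H p q).1 ∈ r.1 → (mp H q s).1 ∈ r.1 → (mp H p s).1 ∈ r.1
  GP : ∀ p : El M, p.1 ∈ G → p.1 ∈ P.1
  GM : ∀ p, p ∈ G → p ∈ M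
  up : ∀ p q : El M, p.1 ∈ G → (mp H p q).1 ∈ r.1 → q.1 ∈ G
  dir : ∀ p q : El M, p.1 ∈ G → q.1 ∈ G → ∃ s : El M, s.1 ∈ G ∧ (mp H s p).1 ∈ r.1 ∧ (mp H s q).1 ∈ r.1
  oneG : one.1 ∈ G
  gen : ∀ D : El M, (∀ p : El M, p.1 ∈ D.1 → p.1 ∈ P.1) →
    (∀ p : El M, p.1 ∈ P.1 → ∃ q : El M, q.1 ∈ D.1 ∧ (mp H q p).1 ∈ r.1) → ∃ q : El M, q.1 ∈ G ∧ q.1 ∈ D.1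

theorem FS_of {M P r one G : ZFSet} (H : TM M) (hf : ForcingNotion M P r one) (hG : IsGeneric M r P G) :
    FS H ⟨P, hf.1⟩ ⟨r, hf.2.1⟩ ⟨one, H.tr.mem_trans hf.2.2.1 hf.1⟩ G := by
  obtain ⟨hP, hr, h1, h2, h3, h4, h5⟩ := hf
  obtain ⟨⟨g1, g2, g3⟩, g4⟩ := hG
  have rP : ∀ q p : ZFSet, ZFSet.pair q p ∈ r → q ∈ P ∧ p ∈ P := by
    intro q p h
    obtain ⟨a, ha, b, hb, e⟩ := h2 _ h
    obtain ⟨rfl, rfl⟩ := ZFSet.pair_injective e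
    exact ⟨ha, hb⟩
  have GM : ∀ p, p ∈ G → p ∈ M := fun p hp => H.tr.mem_trans (g1 hp) hP
  refine ⟨h1, fun q p h => rP _ _ h, fun p hp => h3 _ hp, fun p q s h h' =>
    h4 _ (rP _ _ h).1 _ (rP _ _ h).2 _ (rP _ _ h').2 h h', fun p hp => g1 hp, GM,
    fun p q hp h => g2 _ hp _ (rP _ _ h).2 h, ?_, ?_, ?_⟩
  · intro p q hp hq
    obtain ⟨z, hz, h, h'⟩ := g3 _ hp _ hq
    exact ⟨⟨z, GM z hz⟩, hz, h, h'⟩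
  · obtain ⟨q, hq, -⟩ := g4 P hP ⟨fun x hx => hx, fun p hp => ⟨p, hp, h3 p hp⟩⟩
    exact g2 q hq one h1 (h5 q (g1 hq))
  · intro D hD1 hD2
    obtain ⟨q, hq, h⟩ := g4 D.1 D.2 ⟨fun x hx => hD1 ⟨x, H.mem hx⟩ hx, fun p hp => by
      obtain ⟨q, hq, h⟩ := hD2 ⟨p, H.tr.mem_trans hp hP⟩ hp
      exact ⟨q.1, hq, h⟩⟩
    exact ⟨⟨q, GM q hq⟩, hq, h⟩

section
variable {M : ZFSet} {H : TM M} {P r one : El M} {G : ZFSet} (F : FS H P r one G)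

theorem mem_zvalE (F : FS H P r one G) (τ : El M) (x : ZFSet) : x ∈ zval G τ.1 ↔
    ∃ σ p : El M, p.1 ∈ G ∧ (mp H σ p).1 ∈ τ.1 ∧ x = zval G σ.1 := by
  rw [mem_zval]
  constructor
  · rintro ⟨σ, p, hp, h, e⟩
    exact ⟨⟨σ, H.left (H.mem h)⟩, ⟨p, F.GM p hp⟩, hp, h, e⟩
  · rintro ⟨σ, p, hp, h, e⟩
    exact ⟨_, _, hp, h, e⟩

/-- density -/
theorem FS.dens (F : FS H P r one G) (E : El M → Prop) (hE : D (fun w : Fin 1 → El M => E (w 0))) (p : El M)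
    (hp : p.1 ∈ G) (h : ∀ q : El M, (mp H q p).1 ∈ r.1 → ∃ q' : El M, (mp H q' q).1 ∈ r.1 ∧ E q') :
    ∃ q : El M, q.1 ∈ G ∧ E q := by
  obtain ⟨B, hB⟩ := H.ax.sep (fun q => E q ∨ ¬ ∃ s : El M, (mp H s p).1 ∈ r.1 ∧ (mp H s q).1 ∈ r.1) (by
    repeat' first
    | exact DF_var _
    | exact DF_const _
    | with_reducible apply DF_mp
    | with_reducible apply D_mem
    | with_reducible apply D_or
    | with_reducible apply D_and
    | with_reducible apply D_not
    | with_reducible apply D_ex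
    | exact hE) P
  obtain ⟨q, hq, hqB⟩ := F.gen B (fun p hp => ((hB p).1 hp).1) (by
    intro q hq
    by_cases hs : ∃ s : El M, (mp H s p).1 ∈ r.1 ∧ (mp H s q).1 ∈ r.1
    · obtain ⟨s, h1, h2⟩ := hs
      obtain ⟨q', h3, h4⟩ := h s h1
      exact ⟨q', (hB _).2 ⟨(F.rP _ _ h3).1, Or.inl h4⟩, F.trans _ _ _ h3 h2⟩
    · exact ⟨q, (hB _).2 ⟨hq, Or.inr hs⟩, F.refl q hq⟩)
  rcases ((hB _).1 hqB).2 with h1 | h1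
  · exact ⟨q, hq, h1⟩
  · obtain ⟨s, -, h2, h3⟩ := F.dir p q hp hq
    exact (h1 ⟨s, h2, h3⟩).elim

/-- half of the operator for forcing equality -/
def HFop (H : TM M) (r : El M) (T : El M → El M → El M → Prop) (p σ τ : El M) : Prop :=
  ∀ π s : El M, (mp H π s).1 ∈ σ.1 → ∀ q : El M, (mp H q p).1 ∈ r.1 → (mp H q s).1 ∈ r.1 →
    ∃ q' π' s' : El M, (mp H q' q).1 ∈ r.1 ∧ (mp H π' s').1 ∈ τ.1 ∧ (mp H q' s').1 ∈ r.1 ∧ T q' π π'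

def EQop (H : TM M) (r : El M) (T : El M → El M → El M → Prop) (p σ τ : El M) : Prop :=
  HFop H r T p σ τ ∧ HFop H r (fun p a b => T p b a) p τ σ

theorem HFop_mono (S T : El M → El M → El M → Prop) (h : ∀ x y z, S x y z → T x y z) (x y z : El M)
    (h1 : HFop H r S x y z) : HFop H r T x y z := by
  intro π s h2 q h3 h4
  obtain ⟨q', π', s', h5, h6, h7, h8⟩ := h1 π s h2 q h3 h4
  exact ⟨q', π', s', h5, h6, h7, h _ _ _ h8⟩

theorem HFop_loc (F : FS H P r one G) (A : El M) (hA : ∀ u v : El M, u.1 ∈ A.1 → v.1 ∈ u.1 → v.1 ∈ A.1)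
    (hP : ∀ u : El M, u.1 ∈ P.1 → u.1 ∈ A.1) (T : El M → El M → El M → Prop) (p x y : El M)
    (hx : x.1 ∈ A.1) (hy : y.1 ∈ A.1) (h : HFop H r T p x y) :
    HFop H r (fun x y z => T x y z ∧ x.1 ∈ A.1 ∧ y.1 ∈ A.1 ∧ z.1 ∈ A.1) p x y := by
  intro π s h2 q h3 h4
  obtain ⟨q', π', s', h5, h6, h7, h8⟩ := h π s h2 q h3 h4
  exact ⟨q', π', s', h5, h6, h7, h8, hP _ (F.rP _ _ h5).1, (H.trpair hA hx h2).1, (H.trpair hA hy h6).1⟩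

theorem EQop_Op (F : FS H P r one G) : Op H (EQop H r) P where
  mono := by
    rintro S T h x y z ⟨h1, h2⟩
    exact ⟨HFop_mono _ _ h _ _ _ h1, HFop_mono _ _ (fun x y z => h x z y) _ _ _ h2⟩
  dfn := by
    unfold EQop HFop
    repeat' first
    | exact DF_var _
    | exact DF_const _
    | with_reducible apply DF_tp
    | with_reducible apply DF_mp
    | with_reducible apply D_mem
    | with_reducible apply D_and
    | with_reducible apply D_imp
    | with_reducible apply D_all
    | with_reducible apply D_ex
  loc := by
    rintro A hA hP T p x y hp hx hy ⟨h1, h2⟩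
    refine ⟨HFop_loc F A hA hP T p x y hx hy h1, ?_⟩
    exact HFop_mono _ _ (fun x y z h => ⟨h.1, h.2.1, h.2.2.2, h.2.2.1⟩) _ _ _
      (HFop_loc F A hA hP (fun p a b => T p b a) p y x hy hx h2)

/-- forcing equality -/
def FEq (H : TM M) (r : El M) (p σ τ : El M) : Prop := GF H (EQop H r) p σ τ

theorem D_FEq (F : FS H P r one G) : D (fun w : Fin 3 → El M => FEq H r (w 0) (w 1) (w 2)) :=
  D_GF H (EQop_Op F)

theorem FEq_iff (F : FS H P r one G) (p σ τ : El M) : FEq H r p σ τ ↔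
    HFop H r (FEq H r) p σ τ ∧ HFop H r (fun p a b => FEq H r p b a) p τ σ :=
  ⟨GF_unf H (EQop_Op F), GF_fold H (EQop_Op F)⟩

theorem FEq_mono (F : FS H P r one G) {p q σ τ : El M} (h : FEq H r p σ τ) (hq : (mp H q p).1 ∈ r.1) :
    FEq H r q σ τ := by
  rw [FEq_iff F] at h ⊢
  exact ⟨fun π s h2 q' h3 h4 => h.1 π s h2 q' (F.trans _ _ _ h3 hq) h4,
    fun π s h2 q' h3 h4 => h.2 π s h2 q' (F.trans _ _ _ h3 hq) h4⟩

/-- truth, half of one direction -/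
theorem HF_sub (F : FS H P r one G) (T : El M → El M → El M → Prop)
    (hT : D (fun w : Fin 3 → El M => T (w 0) (w 1) (w 2))) (p σ τ : El M) (hp : p.1 ∈ G)
    (h : HFop H r T p σ τ)
    (hv : ∀ π s π' s' q : El M, (mp H π s).1 ∈ σ.1 → (mp H π' s').1 ∈ τ.1 → q.1 ∈ G → T q π π' →
      zval G π.1 = zval G π'.1) : zval G σ.1 ⊆ zval G τ.1 := by
  intro x hx
  obtain ⟨π, s, hs, h1, rfl⟩ := (mem_zvalE F _ _).1 hx
  obtain ⟨q0, hq0, h2, h3⟩ := F.dir p s hp hs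
  obtain ⟨q, hq, π', s', h4, h5, h6⟩ := F.dens (fun q' => ∃ π' s' : El M, (mp H π' s').1 ∈ τ.1 ∧
      (mp H q' s').1 ∈ r.1 ∧ T q' π π') (by
    repeat' first
    | exact DF_var _
    | exact DF_const _
    | with_reducible apply DF_mp
    | with_reducible apply D_mem
    | with_reducible apply D_and
    | with_reducible apply D_ex
    | refine D_ap3 (R := T) hT ?_ ?_ ?_) q0 hq0 (by
    intro q hq
    obtain ⟨q', π', s', h5, h6, h7, h8⟩ := h π s h1 q (F.trans _ _ _ hq h2) (F.trans _ _ _ hq h3)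
    exact ⟨q', h5, π', s', h6, h7, h8⟩)
  exact (mem_zvalE F _ _).2 ⟨π', s', F.up _ _ hq h5, h4, hv _ _ _ _ _ h1 h4 hq h6⟩

/-- obstruction -/
def Bad (H : TM M) (r : El M) (T : El M → El M → El M → Prop) (p σ τ : El M) : Prop :=
  ∃ π s : El M, (mp H π s).1 ∈ σ.1 ∧ (mp H p s).1 ∈ r.1 ∧ ∀ q π' s' : El M, (mp H q p).1 ∈ r.1 →
    (mp H π' s').1 ∈ τ.1 → (mp H q s').1 ∈ r.1 → ¬ T q π π'

theorem D_Bad {T : El M → El M → El M → Prop}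
    (hT : D (fun w : Fin 3 → El M => T (w 0) (w 1) (w 2))) :
    D (fun w : Fin 3 → El M => Bad H r T (w 0) (w 1) (w 2)) := by
  unfold Bad
  repeat' first
    | exact DF_var _
    | exact DF_const _
    | with_reducible apply DF_mp
    | with_reducible apply D_mem
    | with_reducible apply D_and
    | with_reducible apply D_not
    | with_reducible apply D_imp
    | with_reducible apply D_ex
    | with_reducible apply D_all
    | refine D_ap3 (R := T) hT ?_ ?_ ?_

theorem HF_or_bad {T : El M → El M → El M → Prop} {p σ τ : El M} (h : ¬ HFop H r T p σ τ) :
    ∃ q : El M, (mp H q p).1 ∈ r.1 ∧ Bad H r T q σ τ := by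
  unfold HFop at h
  push Not at h
  obtain ⟨π, s, h1, q, h2, h3, h4⟩ := h
  exact ⟨q, h2, π, s, h1, h3, fun q' π' s' a b c => h4 q' π' s' a b c⟩

theorem not_bad (F : FS H P r one G) {T : El M → El M → El M → Prop} {p σ τ : El M} (hp : p.1 ∈ G)
    (e : zval G σ.1 ⊆ zval G τ.1)
    (hm : ∀ p q a b : El M, T p a b → (mp H q p).1 ∈ r.1 → T q a b)
    (hv : ∀ π s π' s' : El M, (mp H π s).1 ∈ σ.1 → (mp H π' s').1 ∈ τ.1 →
      zval G π.1 = zval G π'.1 → ∃ q : El M, q.1 ∈ G ∧ T q π π') : ¬ Bad H r T p σ τ := by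
  rintro ⟨π, s, h1, h2, h3⟩
  have : zval G π.1 ∈ zval G τ.1 := e ((mem_zvalE F _ _).2 ⟨π, s, F.up _ _ hp h2, h1, rfl⟩)
  obtain ⟨π', s', hs', h4, h5⟩ := (mem_zvalE F _ _).1 this
  obtain ⟨q0, hq0, h6⟩ := hv _ _ _ _ h1 h4 h5
  obtain ⟨q1, hq1, h7, h8⟩ := F.dir p q0 hp hq0
  obtain ⟨q2, hq2, h9, h10⟩ := F.dir q1 s' hq1 hs'
  exact h3 q2 π' s' (F.trans _ _ _ h9 h7) h4 h10 (hm _ _ _ _ h6 (F.trans _ _ _ h9 h8))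

theorem pair_rank {π s σ : El M} (h : (mp H π s).1 ∈ σ.1) : π.1.rank < σ.1.rank := by
  refine lt_trans ?_ (ZFSet.rank_lt_of_mem h)
  refine lt_trans (ZFSet.rank_lt_of_mem (y := π.1) (x := {π.1}) (by simp)) (ZFSet.rank_lt_of_mem (by simp [mp, ZFSet.pair]))

theorem truth_eq (F : FS H P r one G) (σ τ : El M) : zval G σ.1 = zval G τ.1 ↔
    ∃ p : El M, p.1 ∈ G ∧ FEq H r p σ τ := by
  induction σ using (InvImage.wf (fun y : El M => y.1.rank) Ordinal.lt_wf).induction generalizing τ with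
  | _ σ ih =>
  have ih' : ∀ π s : El M, (mp H π s).1 ∈ σ.1 → ∀ τ : El M, zval G π.1 = zval G τ.1 ↔
    ∃ p : El M, p.1 ∈ G ∧ FEq H r p π τ := fun π s h τ => ih π (pair_rank h) τ
  have hD := D_FEq F
  have hD' : D (fun w : Fin 3 → El M => FEq H r (w 0) (w 2) (w 1)) :=
    D_ap3 (R := FEq H r) hD (DF_var _) (DF_var _) (DF_var _)
  constructor
  · intro e
    obtain ⟨p, hp, h⟩ := F.dens (fun p => FEq H r p σ τ ∨ Bad H r (FEq H r) p σ τ ∨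
      Bad H r (fun p a b => FEq H r p b a) p τ σ) (by
      refine D_or ?_ (D_or ?_ ?_)
      · exact D_ap3 (R := FEq H r) hD (DF_var _) (DF_const _) (DF_const _)
      · exact D_ap3 (R := Bad H r (FEq H r)) (D_Bad hD) (DF_var _) (DF_const _) (DF_const _)
      · exact D_ap3 (R := Bad H r (fun p a b => FEq H r p b a)) (D_Bad hD') (DF_var _) (DF_const _) (DF_const _))
      one F.oneG (by
      intro q hq
      by_cases h1 : HFop H r (FEq H r) q σ τ
      · by_cases h2 : HFop H r (fun p a b => FEq H r p b a) q τ σ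
        · exact ⟨q, F.refl _ (F.rP _ _ hq).1, Or.inl ((FEq_iff F _ _ _).2 ⟨h1, h2⟩)⟩
        · obtain ⟨q', h3, h4⟩ := HF_or_bad h2
          exact ⟨q', h3, Or.inr (Or.inr h4)⟩
      · obtain ⟨q', h3, h4⟩ := HF_or_bad h1
        exact ⟨q', h3, Or.inr (Or.inl h4)⟩)
    have e1 : zval G σ.1 ⊆ zval G τ.1 := by rw [e]
    have e2 : zval G τ.1 ⊆ zval G σ.1 := by rw [e]
    rcases h with h | h | h
    · exact ⟨p, hp, h⟩
    · exact (not_bad F (T := FEq H r) hp e1 (fun p q a b h hq => FEq_mono F h hq)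
        (fun π s π' s' h1 h2 h3 => (ih' π s h1 π').1 h3) h).elim
    · exact (not_bad F (T := fun p a b => FEq H r p b a) hp e2 (fun p q a b h hq => FEq_mono F h hq)
        (fun π s π' s' h1 h2 h3 => (ih' π' s' h2 π).1 h3.symm) h).elim
  · rintro ⟨p, hp, h⟩
    obtain ⟨h1, h2⟩ := (FEq_iff F _ _ _).1 h
    have a := HF_sub F _ hD p σ τ hp h1 (fun π s π' s' q h1 h2 h3 h4 => (ih' π s h1 π').2 ⟨q, h3, h4⟩)
    have b := HF_sub F _ hD' p τ σ hp h2 (fun π s π' s' q h1 h2 h3 h4 => ((ih' π' s' h2 π).2 ⟨q, h3, h4⟩).symm)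
    exact ZFSet.ext fun z => ⟨fun h => a h, fun h => b h⟩

/-- forcing membership -/
def FMem (H : TM M) (r : El M) (p σ τ : El M) : Prop := ∀ q : El M, (mp H q p).1 ∈ r.1 →
  ∃ q' π s : El M, (mp H q' q).1 ∈ r.1 ∧ (mp H π s).1 ∈ τ.1 ∧ (mp H q' s).1 ∈ r.1 ∧ FEq H r q' σ π

theorem D_FMem (F : FS H P r one G) : D (fun w : Fin 3 → El M => FMem H r (w 0) (w 1) (w 2)) := by
  have hD := D_FEq F
  unfold FMem
  repeat' first
    | exact DF_var _
    | exact DF_const _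
    | with_reducible apply DF_mp
    | with_reducible apply D_mem
    | with_reducible apply D_and
    | with_reducible apply D_imp
    | with_reducible apply D_ex
    | with_reducible apply D_all
    | refine D_ap3 (R := FEq H r) hD ?_ ?_ ?_

theorem FMem_mono (F : FS H P r one G) {p q σ τ : El M} (h : FMem H r p σ τ) (hq : (mp H q p).1 ∈ r.1) :
    FMem H r q σ τ := fun q' h' => h q' (F.trans _ _ _ h' hq)

theorem truth_mem (F : FS H P r one G) (σ τ : El M) : zval G σ.1 ∈ zval G τ.1 ↔
    ∃ p : El M, p.1 ∈ G ∧ FMem H r p σ τ := by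
  have hD := D_FEq F
  constructor
  · intro h
    obtain ⟨π, s, hs, h1, e⟩ := (mem_zvalE F _ _).1 h
    obtain ⟨p0, hp0, h2⟩ := (truth_eq F _ _).1 e
    obtain ⟨p, hp, h3, h4⟩ := F.dir s p0 hs hp0
    exact ⟨p, hp, fun q hq => ⟨q, π, s, F.refl _ (F.rP _ _ hq).1, h1, F.trans _ _ _ hq h3,
      FEq_mono F h2 (F.trans _ _ _ hq h4)⟩⟩
  · rintro ⟨p, hp, h⟩
    obtain ⟨q, hq, π', s', h4, h5, h6⟩ := F.dens (fun q' => ∃ π' s' : El M, (mp H π' s').1 ∈ τ.1 ∧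
      (mp H q' s').1 ∈ r.1 ∧ FEq H r q' σ π') (by
      repeat' first
      | exact DF_var _
      | exact DF_const _
      | with_reducible apply DF_mp
      | with_reducible apply D_mem
      | with_reducible apply D_and
      | with_reducible apply D_ex
      | refine D_ap3 (R := FEq H r) hD ?_ ?_ ?_) p hp (by
      intro q hq
      obtain ⟨q', π', s', h5, h6, h7, h8⟩ := h q hq
      exact ⟨q', h5, π', s', h6, h7, h8⟩)
    exact (mem_zvalE F _ _).2 ⟨π', s', F.up _ _ hq h5, h4, (truth_eq F _ _).2 ⟨q, hq, h6⟩⟩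

end


section
variable {M : ZFSet} {H : TM M} {P r one : El M} {G : ZFSet}

/-- definable forcing relation for `X` -/
structure Fr (H : TM M) (r : El M) (G : ZFSet) {n : ℕ} (X : (Fin n → El M) → Prop)
    (K : (Fin n → El M) → El M → Prop) : Prop where
  dfn : D (fun w : Fin (n+1) → El M => K (Fin.init w) (w (Fin.last n)))
  mono : ∀ v p q, K v p → (mp H q p).1 ∈ r.1 → K v q
  truth : ∀ v, X v ↔ ∃ p : El M, p.1 ∈ G ∧ K v p

/-- `X` has a definable forcing relation -/
def Tr (H : TM M) (r : El M) (G : ZFSet) {n : ℕ} (X : (Fin n → El M) → Prop) : Prop := ∃ K, Fr H r G X K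

theorem Fr.sub {n : ℕ} {X : (Fin n → El M) → Prop} {K : (Fin n → El M) → El M → Prop} (h : Fr H r G X K)
    {m : ℕ} {t : (Fin m → El M) → (Fin n → El M)} (ht : ∀ i, DT (fun v => t v i))
    {s : (Fin m → El M) → El M} (hs : DT s) : D (fun w => K (t w) (s w)) := by
  refine (D_subst h.dfn (t := fun w => (Fin.snoc (t w) (s w) : Fin (n+1) → El M)) (DT_snoc ht hs)).congr ?_
  intro v; simp

theorem DT_init {n m : ℕ} {t : (Fin n → El M) → (Fin m → El M)} (ht : ∀ i, DT (fun v => t v i)) :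
    ∀ i, DT (fun w : Fin (n+1) → El M => t (Fin.init w) i) := by
  intro i
  obtain ⟨s, hs⟩ := ht i
  rcases s with c | j
  · exact ⟨Sum.inl c, fun v => hs _⟩
  · exact ⟨Sum.inr j.castSucc, fun v => hs _⟩

theorem Tr_false (n : ℕ) : Tr H r G (fun _ : Fin n → El M => False) :=
  ⟨fun _ _ => False, ⟨⊥, fun v => by simp⟩, fun _ _ _ h => h.elim, fun v => by simp⟩

theorem Tr_eq (F : FS H P r one G) {n : ℕ} (i j : Fin n) :
    Tr H r G (fun v : Fin n → El M => zval G (v i).1 = zval G (v j).1) :=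
  ⟨fun v p => FEq H r p (v i) (v j), D_ap3 (R := FEq H r) (D_FEq F) (DF_var _) (DF_var i.castSucc) (DF_var j.castSucc),
    fun _ _ _ h hq => FEq_mono F h hq, fun v => truth_eq F _ _⟩

theorem Tr_mem (F : FS H P r one G) {n : ℕ} (i j : Fin n) :
    Tr H r G (fun v : Fin n → El M => zval G (v i).1 ∈ zval G (v j).1) :=
  ⟨fun v p => FMem H r p (v i) (v j), D_ap3 (R := FMem H r) (D_FMem F) (DF_var _) (DF_var i.castSucc) (DF_var j.castSucc),
    fun _ _ _ h hq => FMem_mono F h hq, fun v => truth_mem F _ _⟩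

theorem Tr_imp (F : FS H P r one G) {n : ℕ} {X Y : (Fin n → El M) → Prop} (hX : Tr H r G X) (hY : Tr H r G Y) :
    Tr H r G (fun v => X v → Y v) := by
  obtain ⟨K, hK⟩ := hX
  obtain ⟨L, hL⟩ := hY
  refine ⟨fun v p => ∀ q : El M, (mp H q p).1 ∈ r.1 → K v q → ∃ q' : El M, (mp H q' q).1 ∈ r.1 ∧ L v q', ?_, ?_, ?_⟩
  · refine D_all (D_imp ?_ (D_imp ?_ (D_ex (D_and ?_ ?_))))
    · exact D_mem (DF_mp H (DF_var _) (DF_var (Fin.castSucc (Fin.last _)))) (DF_const _)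
    · exact hK.sub (t := fun w : Fin (n+2) → El M => Fin.init (Fin.init w)) (fun i => DT_var i.castSucc.castSucc) (DT_var _)
    · exact D_mem (DF_mp H (DF_var _) (DF_var (Fin.castSucc (Fin.last _)))) (DF_const _)
    · exact hL.sub (t := fun w : Fin (n+3) → El M => Fin.init (Fin.init (Fin.init w)))
        (fun i => DT_var i.castSucc.castSucc.castSucc) (DT_var _)
  · intro v p q h hq q' hq'
    exact h q' (F.trans _ _ _ hq' hq)
  · intro v
    constructor
    · intro h
      by_cases hx : X v
      · obtain ⟨p, hp, h1⟩ := (hL.truth v).1 (h hx)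
        exact ⟨p, hp, fun q hq _ => ⟨q, F.refl _ (F.rP _ _ hq).1, hL.mono _ _ _ h1 hq⟩⟩
      · obtain ⟨p, hp, h1⟩ := F.dens (fun q => K v q ∨ ∀ q' : El M, (mp H q' q).1 ∈ r.1 → ¬ K v q') (by
          refine D_or ?_ (D_all (D_imp ?_ (D_not ?_)))
          · exact hK.sub (t := fun _ => v) (fun i => DT_const _) (DT_var _)
          · exact D_mem (DF_mp H (DF_var _) (DF_var (Fin.castSucc 0))) (DF_const _)
          · exact hK.sub (t := fun _ => v) (fun i => DT_const _) (DT_var _)) one F.oneG (by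
          intro q hq
          by_cases h2 : ∃ q' : El M, (mp H q' q).1 ∈ r.1 ∧ K v q'
          · obtain ⟨q', h3, h4⟩ := h2
            exact ⟨q', h3, Or.inl h4⟩
          · push Not at h2
            exact ⟨q, F.refl _ (F.rP _ _ hq).1, Or.inr h2⟩)
        rcases h1 with h1 | h1
        · exact (hx ((hK.truth v).2 ⟨p, hp, h1⟩)).elim
        · exact ⟨p, hp, fun q hq h2 => (h1 q hq h2).elim⟩
    · rintro ⟨p, hp, h⟩ hx
      obtain ⟨p0, hp0, h1⟩ := (hK.truth v).1 hx
      obtain ⟨q, hq, h2, h3⟩ := F.dir p p0 hp hp0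
      refine (hL.truth v).2 (F.dens (fun q => L v q) (hL.sub (t := fun _ => v) (fun i => DT_const _) (DT_var _)) q hq ?_)
      intro q1 hq1
      exact h q1 (F.trans _ _ _ hq1 h2) (hK.mono _ _ _ h1 (F.trans _ _ _ hq1 h3))

theorem Tr_all (F : FS H P r one G) {n : ℕ} {X : (Fin (n+1) → El M) → Prop} (hX : Tr H r G X) :
    Tr H r G (fun v : Fin n → El M => ∀ τ : El M, X (Fin.snoc v τ : Fin (n+1) → El M)) := by
  obtain ⟨K, hK⟩ := hX
  refine ⟨fun v p => ∀ τ q : El M, (mp H q p).1 ∈ r.1 → ∃ q' : El M, (mp H q' q).1 ∈ r.1 ∧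
    K (Fin.snoc v τ : Fin (n+1) → El M) q', ?_, ?_, ?_⟩
  · refine D_all (D_all (D_imp ?_ (D_ex (D_and ?_ ?_))))
    · exact D_mem (DF_mp H (DF_var _) (DF_var (Fin.castSucc (Fin.castSucc (Fin.last _))))) (DF_const _)
    · exact D_mem (DF_mp H (DF_var _) (DF_var (Fin.castSucc (Fin.last _)))) (DF_const _)
    · exact hK.sub (DT_snoc (t := fun w : Fin (n+4) → El M => Fin.init (Fin.init (Fin.init (Fin.init w))))
        (fun i => DT_var i.castSucc.castSucc.castSucc.castSucc) (DT_var (Fin.castSucc (Fin.castSucc (Fin.last _))))) (DT_var _)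
  · intro v p q h hq τ q' hq'
    exact h τ q' (F.trans _ _ _ hq' hq)
  · intro v
    constructor
    · intro h
      obtain ⟨p, hp, h1⟩ := F.dens (fun p => (∀ τ q : El M, (mp H q p).1 ∈ r.1 → ∃ q' : El M, (mp H q' q).1 ∈ r.1 ∧
          K (Fin.snoc v τ : Fin (n+1) → El M) q') ∨ ∃ τ : El M, ∀ q' : El M, (mp H q' p).1 ∈ r.1 →
          ¬ K (Fin.snoc v τ : Fin (n+1) → El M) q') (by
        refine D_or (D_all (D_all (D_imp ?_ (D_ex (D_and ?_ ?_))))) (D_ex (D_all (D_imp ?_ (D_not ?_))))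
        · exact D_mem (DF_mp H (DF_var _) (DF_var 0)) (DF_const _)
        · exact D_mem (DF_mp H (DF_var _) (DF_var 2)) (DF_const _)
        · exact hK.sub (DT_snoc (t := fun _ => v) (fun i => DT_const _) (DT_var 1)) (DT_var _)
        · exact D_mem (DF_mp H (DF_var _) (DF_var 0)) (DF_const _)
        · exact hK.sub (DT_snoc (t := fun _ => v) (fun i => DT_const _) (DT_var 1)) (DT_var _)) one F.oneG (by
        intro q hq
        by_cases h2 : (∀ τ q1 : El M, (mp H q1 q).1 ∈ r.1 → ∃ q' : El M, (mp H q' q1).1 ∈ r.1 ∧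
          K (Fin.snoc v τ : Fin (n+1) → El M) q')
        · exact ⟨q, F.refl _ (F.rP _ _ hq).1, Or.inl h2⟩
        · push Not at h2
          obtain ⟨τ, q1, h3, h4⟩ := h2
          exact ⟨q1, h3, Or.inr ⟨τ, h4⟩⟩)
      rcases h1 with h1 | ⟨τ, h1⟩
      · exact ⟨p, hp, h1⟩
      · obtain ⟨p0, hp0, h2⟩ := (hK.truth _).1 (h τ)
        obtain ⟨q, hq, h3, h4⟩ := F.dir p p0 hp hp0
        exact (h1 q h3 (hK.mono _ _ _ h2 h4)).elim
    · rintro ⟨p, hp, h⟩ τ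
      refine (hK.truth _).2 (F.dens (fun q => K (Fin.snoc v τ : Fin (n+1) → El M) q) (hK.sub (t := fun _ => (Fin.snoc v τ : Fin (n+1) → El M))
        (fun i => DT_const _) (DT_var _)) p hp ?_)
      intro q1 hq1
      exact h τ q1 hq1

/-- value as an element of the extension -/
noncomputable def vl (G : ZFSet) (τ : El M) : El (genExt M G) := ⟨zval G τ.1, (mem_genExt _ _ _).2 ⟨_, τ.2, rfl⟩⟩

theorem vl_surj (x : El (genExt M G)) : ∃ τ : El M, vl G τ = x := by
  obtain ⟨τ, h, e⟩ := (mem_genExt _ _ _).1 x.2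
  exact ⟨⟨τ, h⟩, Subtype.ext e⟩

theorem term_var {n : ℕ} (t : SetLang.Term (Empty ⊕ Fin n)) : ∃ i : Fin n, t = Term.var (Sum.inr i) := by
  cases t with
  | var x =>
    rcases x with x | i
    · exact x.elim
    · exact ⟨i, rfl⟩
  | func f _ => exact f.elim

theorem Tr_form (F : FS H P r one G) {n : ℕ} (φ : BF n) :
    Tr H r G (fun v : Fin n → El M => φ.Realize (default : Empty → El (genExt M G)) (fun i => vl G (v i))) := by
  induction φ with
  | falsum => exact Tr_false _
  | equal t s =>
    obtain ⟨i, rfl⟩ := term_var t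
    obtain ⟨j, rfl⟩ := term_var s
    obtain ⟨K, h1, h2, h3⟩ := Tr_eq F i j
    refine ⟨K, h1, h2, fun v => Iff.trans ?_ (h3 v)⟩
    exact Subtype.ext_iff
  | rel R ts =>
    cases R
    obtain ⟨i, hi⟩ := term_var (ts 0)
    obtain ⟨j, hj⟩ := term_var (ts 1)
    obtain ⟨K, h1, h2, h3⟩ := Tr_mem F i j
    refine ⟨K, h1, h2, fun v => Iff.trans ?_ (h3 v)⟩
    change ((ts 0).realize (M := El (genExt M G)) _).1 ∈ ((ts 1).realize (M := El (genExt M G)) _).1 ↔ _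
    rw [hi, hj]
    exact Iff.rfl
  | imp φ ψ ih1 ih2 => exact Tr_imp F ih1 ih2
  | all φ ih =>
    obtain ⟨K, h1, h2, h3⟩ := Tr_all F ih
    refine ⟨K, h1, h2, fun v => Iff.trans ?_ (h3 v)⟩
    rw [BoundedFormula.realize_all]
    have key : ∀ τ : El M, (fun i => vl G ((Fin.snoc v τ : Fin (_+1) → El M) i)) = Fin.snoc (fun i => vl G (v i)) (vl G τ) := by
      intro τ
      funext i
      refine Fin.lastCases ?_ (fun i => ?_) i <;> simp
    constructor
    · intro h τ
      have := h (vl G τ)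
      beta_reduce
      rw [key]; exact this
    · intro h x
      obtain ⟨τ, rfl⟩ := vl_surj x
      have := h τ
      beta_reduce at this
      rw [key] at this; exact this

end


section
variable {M : ZFSet} {H : TM M} {P r one : El M} {G : ZFSet}

theorem vl_snoc {n : ℕ} (v : Fin n → El M) (τ : El M) :
    (fun i => vl G ((Fin.snoc v τ : Fin (n+1) → El M) i)) = (Fin.snoc (fun i => vl G (v i)) (vl G τ) : Fin (n+1) → El (genExt M G)) := by
  funext i
  refine Fin.lastCases ?_ (fun i => ?_) i <;> simp

theorem mem_vl (F : FS H P r one G) (τ : El M) (x : El (genExt M G)) : x.1 ∈ (vl G τ).1 ↔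
    ∃ σ p : El M, p.1 ∈ G ∧ (mp H σ p).1 ∈ τ.1 ∧ x = vl G σ := by
  refine (mem_zvalE F τ x.1).trans ?_
  simp only [Subtype.ext_iff]
  rfl

/-- the names in a transitive set -/
theorem FS.tcn (F : FS H P r one G) (α : El M) : ∃ A : El M,
    (∀ u v : El M, u.1 ∈ A.1 → v.1 ∈ u.1 → v.1 ∈ A.1) ∧ α.1 ∈ A.1 ∧
    ∀ τ : El M, τ.1 ∈ A.1 → ∀ x : El (genExt M G), x.1 ∈ (vl G τ).1 → ∃ σ : El M, σ.1 ∈ A.1 ∧ x = vl G σ := by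
  obtain ⟨A, h1, h2⟩ := H.tc ⟨_, H.sing α⟩
  refine ⟨A, h1, h2 α (by simp), fun τ hτ x hx => ?_⟩
  obtain ⟨σ, p, hp, h, e⟩ := (mem_vl F _ _).1 hx
  exact ⟨σ, (H.trpair h1 hτ h).1, e⟩

theorem FS.NB (F : FS H P r one G) (B : El M) : ∃ b : El (genExt M G), ∀ x : El (genExt M G),
    x.1 ∈ b.1 ↔ ∃ τ : El M, τ.1 ∈ B.1 ∧ x = vl G τ := by
  obtain ⟨c, hc⟩ := H.prod B ⟨_, H.sing one⟩
  refine ⟨vl G c, fun x => (mem_vl F _ _).trans ?_⟩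
  constructor
  · rintro ⟨σ, p, hp, h, e⟩
    obtain ⟨y, z, h1, h2, h3⟩ := (hc _).1 h
    obtain ⟨rfl, rfl⟩ := mp_inj H h1
    exact ⟨σ, h2, e⟩
  · rintro ⟨τ, h, e⟩
    exact ⟨τ, one, F.oneG, (hc _).2 ⟨τ, one, rfl, h, by simp⟩, e⟩

theorem FS.nm (F : FS H P r one G) (A C : El M) (hC : ∀ x : El M, x.1 ∈ C.1 ↔
    ∃ y z : El M, x = mp H y z ∧ y.1 ∈ A.1 ∧ z.1 ∈ P.1) (S : El M → El M → Prop)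
    (hS : D (fun w : Fin 2 → El M => S (w 0) (w 1))) : ∃ ν : El M, ν.1 ⊆ C.1 ∧ ∀ x : El (genExt M G),
      x.1 ∈ (vl G ν).1 ↔ ∃ σ p : El M, p.1 ∈ G ∧ σ.1 ∈ A.1 ∧ S σ p ∧ x = vl G σ := by
  obtain ⟨ν, hν⟩ := H.ax.sep (fun e => ∃ σ p : El M, e = mp H σ p ∧ S σ p) (by
    repeat' first
    | exact DF_var _
    | exact DF_const _
    | with_reducible apply DF_mp
    | with_reducible apply D_eq
    | with_reducible apply D_and
    | with_reducible apply D_ex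
    | refine D_ap2 (R := S) hS ?_ ?_) C
  refine ⟨ν, fun x hx => ((hν ⟨x, H.mem hx⟩).1 hx).1, fun x => (mem_vl F _ _).trans ?_⟩
  constructor
  · rintro ⟨σ, p, hp, h, e⟩
    obtain ⟨h1, σ', p', h2, h3⟩ := (hν _).1 h
    obtain ⟨rfl, rfl⟩ := mp_inj H h2
    obtain ⟨y, z, h4, h5, -⟩ := (hC _).1 h1
    obtain ⟨rfl, rfl⟩ := mp_inj H h4
    exact ⟨σ, p, hp, h5, h3, e⟩
  · rintro ⟨σ, p, hp, h, h1, e⟩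
    exact ⟨σ, p, hp, (hν _).2 ⟨(hC _).2 ⟨σ, p, rfl, h, F.GP _ hp⟩, σ, p, rfl, h1⟩, e⟩

theorem FS.sepS (F : FS H P r one G) : SepS (genExt M G) := by
  intro n φ v A
  choose w hw using fun i => vl_surj (v i)
  obtain ⟨α, rfl⟩ := vl_surj A
  obtain rfl : (fun i => vl G (w i)) = v := funext hw
  obtain ⟨A', h1, h2, h3⟩ := F.tcn α
  obtain ⟨C, hC⟩ := H.prod A' P
  obtain ⟨K, hK⟩ := Tr_form F φ
  obtain ⟨ν, -, hν⟩ := F.nm A' C hC (fun σ p => K (Fin.snoc w σ : Fin (n+1) → El M) p ∧ FMem H r p σ α) (by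
    refine D_and ?_ ?_
    · exact hK.sub (DT_snoc (t := fun _ => w) (fun i => DT_const _) (DT_var 0)) (DT_var _)
    · exact D_ap3 (R := FMem H r) (D_FMem F) (DF_var _) (DF_var _) (DF_const _))
  refine ⟨vl G ν, fun x => (hν x).trans ?_⟩
  constructor
  · rintro ⟨σ, p, hp, hσ, ⟨h4, h5⟩, rfl⟩
    refine ⟨(truth_mem F _ _).2 ⟨p, hp, h5⟩, ?_⟩
    rw [← vl_snoc]
    exact (hK.truth _).2 ⟨p, hp, h4⟩
  · rintro ⟨h4, h5⟩
    obtain ⟨σ, hσ, rfl⟩ := h3 α h2 x h4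
    rw [← vl_snoc] at h5
    obtain ⟨p, hp, h6⟩ := (hK.truth _).1 h5
    obtain ⟨p', hp', h7⟩ := (truth_mem F _ _).1 h4
    obtain ⟨q, hq, h8, h9⟩ := F.dir p p' hp hp'
    exact ⟨σ, q, hq, hσ, ⟨hK.mono _ _ _ h6 h8, FMem_mono F h7 h9⟩, rfl⟩

theorem FS.replS (F : FS H P r one G) : ReplS (genExt M G) := by
  intro n φ v A hf
  choose w hw using fun i => vl_surj (v i)
  obtain ⟨α, rfl⟩ := vl_surj A
  obtain rfl : (fun i => vl G (w i)) = v := funext hw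
  obtain ⟨A', h1, h2, h3⟩ := F.tcn α
  obtain ⟨C, hC⟩ := H.prod A' P
  obtain ⟨K, hK⟩ := Tr_form F φ
  obtain ⟨B, hB⟩ := H.coll (fun e τ => ∃ π p : El M, e = mp H π p ∧
      K (Fin.snoc (Fin.snoc w π : Fin (n+1) → El M) τ : Fin (n+2) → El M) p) (by
    refine D_ex (D_ex (D_and ?_ ?_))
    · exact D_eq (DF_var _) (DF_mp H (DF_var _) (DF_var _))
    · exact hK.sub (DT_snoc (DT_snoc (t := fun _ => w) (fun i => DT_const _) (DT_var 2)) (DT_var 1)) (DT_var _)) C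
  obtain ⟨b, hb⟩ := F.NB B
  obtain ⟨c, hc⟩ := sepD_of F.sepS (fun y => ∃ x : El (genExt M G), x.1 ∈ (vl G α).1 ∧
     φ.Realize (default : Empty → El (genExt M G)) (Fin.snoc (Fin.snoc (fun i => vl G (w i)) x : Fin (n+1) → El _) y : Fin (n+2) → El _)) (by
    refine D_ex (D_and (D_mem (DF_var _) (DF_const _)) ?_)
    exact D_ap2 (R := fun x y => φ.Realize (default : Empty → El (genExt M G)) (Fin.snoc (Fin.snoc (fun i => vl G (w i)) x : Fin (n+1) → El _) y : Fin (n+2) → El _))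
      (D_bf2 φ _) (DF_var _) (DF_var _)) b
  refine ⟨c, fun y => (hc y).trans ⟨fun h => h.2, fun h => ⟨?_, h⟩⟩⟩
  obtain ⟨x, hx, h⟩ := h
  obtain ⟨π, hπ, rfl⟩ := h3 α h2 x hx
  obtain ⟨υ, rfl⟩ := vl_surj y
  have h' := h
  rw [← vl_snoc, ← vl_snoc] at h'
  obtain ⟨p, hp, h6⟩ := (hK.truth _).1 h'
  obtain ⟨τ, hτ, π', p', h7, h8⟩ := hB (mp H π p) ((hC _).2 ⟨π, p, rfl, hπ, F.GP _ hp⟩) ⟨υ, π, p, rfl, h6⟩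
  obtain ⟨rfl, rfl⟩ := mp_inj H h7
  have h9 := (hK.truth _).2 ⟨p, hp, h8⟩
  beta_reduce at h9
  rw [vl_snoc, vl_snoc] at h9
  exact (hb _).2 ⟨τ, hτ, hf _ hx _ _ h h9⟩

theorem FS.check (F : FS H P r one G) (x c : El M) (h : GF H (CKop H) one x c) : zval G c.1 = x.1 := by
  induction x using H.ind generalizing c with
  | h x ih =>
  obtain ⟨h1, h2⟩ := GF_unf H (CKop_Op H one) h
  apply ZFSet.ext
  intro z
  rw [mem_zvalE F]
  constructor
  · rintro ⟨σ, p, hp, h3, rfl⟩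
    obtain ⟨d, y, h4, h5, h6⟩ := h2 _ h3
    obtain ⟨rfl, rfl⟩ := mp_inj H h4
    rw [ih y h5 _ h6]; exact h5
  · intro hz
    obtain ⟨d, h3, h4⟩ := h1 ⟨z, H.mem hz⟩ hz
    exact ⟨d, one, F.oneG, h3, (ih _ hz _ h4).symm⟩

theorem FS.sub (F : FS H P r one G) (x : El M) : x.1 ∈ genExt M G := by
  obtain ⟨c, hc⟩ := (CK_ex H one x).1
  exact (mem_genExt _ _ _).2 ⟨c.1, c.2, F.check x c hc⟩

theorem FS.tr (F : FS H P r one G) : (genExt M G).IsTransitive := by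
  intro y hy x hx
  obtain ⟨τ, hτ, rfl⟩ := (mem_genExt _ _ _).1 hy
  obtain ⟨σ, p, -, -, rfl⟩ := (mem_zvalE F ⟨τ, hτ⟩ x).1 hx
  exact (vl G σ).2

theorem FS.axN (F : FS H P r one G) : Ax (genExt M G) where
  sep := sepD_of F.sepS
  repl := replD_of F.replS
  pair := by
    intro a b
    obtain ⟨α, rfl⟩ := vl_surj a
    obtain ⟨β, rfl⟩ := vl_surj b
    obtain ⟨c, hc⟩ := F.NB ⟨_, H.upair α β⟩
    refine ⟨c, fun x => (hc x).trans ?_⟩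
    constructor
    · rintro ⟨τ, h, rfl⟩
      rcases ZFSet.mem_pair.1 h with h | h
      · rw [Subtype.ext h]; exact Or.inl rfl
      · rw [Subtype.ext h]; exact Or.inr rfl
    · rintro (rfl | rfl)
      · exact ⟨α, by simp, rfl⟩
      · exact ⟨β, by simp, rfl⟩
  union := by
    intro a
    obtain ⟨α, rfl⟩ := vl_surj a
    obtain ⟨A', h1, h2, h3⟩ := F.tcn α
    obtain ⟨b, hb⟩ := F.NB A'
    obtain ⟨c, hc⟩ := sepD_of F.sepS (fun x => ∃ y : El (genExt M G), y.1 ∈ (vl G α).1 ∧ x.1 ∈ y.1)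
      (D_ex (D_and (D_mem (DF_var _) (DF_const _)) (D_mem (DF_var (Fin.castSucc 0)) (DF_var _)))) b
    refine ⟨c, fun x => (hc x).trans ⟨fun h => h.2, fun h => ⟨?_, h⟩⟩⟩
    obtain ⟨y, hy, hx⟩ := h
    obtain ⟨π, hπ, rfl⟩ := h3 _ h2 _ hy
    exact (hb _).2 (h3 _ hπ _ hx)
  pow := by
    intro a
    obtain ⟨α, rfl⟩ := vl_surj a
    obtain ⟨A', h1, h2, h3⟩ := F.tcn α
    obtain ⟨C, hC⟩ := H.prod A' P
    obtain ⟨Q, hQ⟩ := H.pw C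
    obtain ⟨b, hb⟩ := F.NB Q
    obtain ⟨c, hc⟩ := sepD_of F.sepS (fun x => ∀ z : El (genExt M G), z.1 ∈ x.1 → z.1 ∈ (vl G α).1)
      (D_all (D_imp (D_mem (DF_var _) (DF_var (Fin.castSucc 0))) (D_mem (DF_var _) (DF_const _)))) b
    refine ⟨c, fun x => (hc x).trans ⟨fun h => h.2, fun h => ⟨?_, h⟩⟩⟩
    obtain ⟨χ, rfl⟩ := vl_surj x
    obtain ⟨ν, hν1, hν⟩ := F.nm A' C hC (fun σ p => FMem H r p σ χ)
      (D_ap3 (R := FMem H r) (D_FMem F) (DF_var _) (DF_var _) (DF_const _))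
    refine (hb _).2 ⟨ν, (hQ _).2 hν1, ?_⟩
    have key : ∀ z : El (genExt M G), z.1 ∈ (vl G χ).1 ↔ z.1 ∈ (vl G ν).1 := by
      intro z
      rw [hν]
      constructor
      · intro hz
        obtain ⟨σ, hσ, rfl⟩ := h3 _ h2 _ (h z hz)
        obtain ⟨p, hp, h4⟩ := (truth_mem F _ _).1 hz
        exact ⟨σ, p, hp, hσ, h4, rfl⟩
      · rintro ⟨σ, p, hp, hσ, h4, rfl⟩
        exact (truth_mem F _ _).2 ⟨p, hp, h4⟩
    apply Subtype.ext
    apply ZFSet.ext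
    intro z
    exact ⟨fun hz => (key ⟨z, F.tr.mem_trans hz (vl G χ).2⟩).1 hz, fun hz => (key ⟨z, F.tr.mem_trans hz (vl G ν).2⟩).2 hz⟩
  inf := by
    obtain ⟨w, ⟨e, he, he'⟩, hw⟩ := H.ax.inf
    refine ⟨⟨w.1, F.sub w⟩, ⟨⟨e.1, F.sub e⟩, he, fun z hz => he' ⟨z.1, H.mem hz⟩ hz⟩, ?_⟩
    intro x hx
    obtain ⟨y, hy, h⟩ := hw ⟨x.1, H.mem hx⟩ hx
    refine ⟨⟨y.1, F.sub y⟩, hy, fun z => ⟨fun hz => ?_, ?_⟩⟩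
    · rcases (h ⟨z.1, H.mem hz⟩).1 hz with h | h
      · exact Or.inl h
      · have h' := Subtype.mk.inj h; exact Or.inr (Subtype.ext h')
    · rintro (hz | rfl)
      · exact (h ⟨z.1, H.tr.mem_trans hz (H.mem hx)⟩).2 (Or.inl hz)
      · exact (h ⟨z.1, H.mem hx⟩).2 (Or.inr rfl)

end


/-- the generic extension of a ctm of `ZF` models `ZF`. -/
theorem genExt_models_ZF (M : ZFSet) (hcount : M.toSet.Countable)
    (htrans : M.IsTransitive) (hmodel : ZModels M ZF)
    (P r one : ZFSet) (hforcing : ForcingNotion M P r one)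
    (G : ZFSet) (hG : IsGeneric M r P G) :
    ZModels (genExt M G) ZF := by
  have H : TM M := ⟨htrans, Ax_of_models hmodel⟩
  have F := FS_of H hforcing hG
  exact models_of_Ax F.tr F.axN

end CtmForcing
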